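/- arXiv:math/0302346 — 11 statements merged into one kernel-verified Lean document; each statement's English description precedes it below -/
import Mathlib

section
/- Let p be an odd prime and let G be a finite subgroup of GL_n(ℤ_p). Then the mod p reduction homomorphism GL_n(ℤ_p) → GL_n(F_p), induced by the canonical ring surjection ℤ_p → F_p, is injective on G; equivalently, every matrix of finite order in GL_n(ℤ_p) that is congruent to the identity matrix modulo p equals the identity matrix. -/
open scoped MatrixGroups

lemma aux_sub {K : Type*} [Group K] (G : Subgroup K) (hG : Finite G) (x : K) (hx : x ∈ G) :
    IsOfFinOrder x :=
  G.subtype.isOfFinOrder (isOfFinOrder_of_finite (⟨x, hx⟩ : G))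

lemma aux_expand {R : Type*} [Ring R] (Z : R) (q : ℕ) :
    ∃ W : R, (1 + Z) ^ q = 1 + (q : ℤ) • Z + (q.choose 2 : ℤ) • (Z * Z) + Z * Z * Z * W := by
  induction q with
  | zero => exact ⟨0, by simp⟩
  | succ q ih =>
    obtain ⟨W, hW⟩ := ih
    refine ⟨(q.choose 2 : ℤ) • 1 + W * (1 + Z), ?_⟩
    rw [pow_succ, hW, Nat.choose_succ_succ' q 1, Nat.choose_one_right]
    push_cast
    simp only [add_smul, one_smul, mul_add, add_mul, mul_one, one_mul, smul_mul_assoc,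
      mul_smul_comm, mul_assoc]
    abel

lemma aux_step (p : ℕ) [Fact p.Prime] (hodd : Odd p) (n q k : ℕ) (hq : q.Prime) (hk : 1 ≤ k)
    (Y : Matrix (Fin n) (Fin n) ℤ_[p]) (h : (1 + ((p : ℤ_[p]) ^ k) • Y) ^ q = 1) :
    ∃ Y' : Matrix (Fin n) (Fin n) ℤ_[p], Y = (p : ℤ_[p]) • Y' := by
  have hp0 : (p : ℤ_[p]) ≠ 0 := by exact_mod_cast (Fact.out : p.Prime).ne_zero
  obtain ⟨W, hW⟩ := aux_expand (((p : ℤ_[p]) ^ k) • Y) q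
  rw [h] at hW
  obtain ⟨j, rfl⟩ : ∃ j, k = j + 1 := ⟨k - 1, by omega⟩
  have h1 : (p : ℤ_[p]) ^ (j + 1) • ((q : ℤ_[p]) • Y + ((q.choose 2 : ℤ_[p]) * p ^ (j + 1)) • (Y * Y)
      + ((p : ℤ_[p]) * (p * (p ^ j * p ^ j))) • (Y * Y * Y * W)) = 0 := by
    have h2 := hW.symm
    rw [add_assoc, add_assoc, add_eq_left] at h2
    rw [← h2]
    simp only [← Int.cast_smul_eq_zsmul ℤ_[p], smul_mul_assoc, mul_smul_comm, smul_smul, smul_add,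
      Int.cast_natCast]
    generalize Y * Y * Y * W = T
    generalize Y * Y = S
    module
  have h2 := (smul_eq_zero.1 h1).resolve_left (pow_ne_zero _ hp0)
  by_cases hqp : q = p
  · subst hqp
    have h2q : 2 < q := by
      have := hq.two_le
      rcases hodd with ⟨r, hr⟩
      omega
    obtain ⟨c, hc⟩ := hq.dvd_choose_self (two_ne_zero) h2q
    rw [hc] at h2
    have h3 : (q : ℤ_[q]) • (Y + ((c : ℤ_[q]) * q ^ (j + 1)) • (Y * Y)
      + ((q * (q ^ j * q ^ j) : ℤ_[q])) • (Y * Y * Y * W)) = 0 := by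
      rw [← h2]
      simp only [smul_add, smul_smul]
      push_cast
      simp only [mul_assoc]
    have h4 := (smul_eq_zero.1 h3).resolve_left hp0
    refine ⟨-(((c : ℤ_[q]) * q ^ j) • (Y * Y) + ((q ^ j * q ^ j : ℤ_[q])) • (Y * Y * Y * W)), ?_⟩
    rw [add_assoc] at h4
    refine (eq_neg_of_add_eq_zero_left h4).trans ?_
    generalize Y * Y * Y * W = T
    generalize Y * Y = S
    module
  · have hu : IsUnit (q : ℤ_[p]) := by
      rw [PadicInt.isUnit_iff]
      have : ¬ (p ∣ q) := fun hd => hqp ((Nat.prime_dvd_prime_iff_eq Fact.out hq).1 hd).symm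
      by_contra hne
      have hlt := lt_of_le_of_ne (PadicInt.norm_le_one _) hne
      exact this (by exact_mod_cast (PadicInt.norm_int_lt_one_iff_dvd (q : ℤ)).1 (by exact_mod_cast hlt))
    obtain ⟨v, hv⟩ := hu.exists_left_inv
    refine ⟨v • -(((q.choose 2 : ℤ_[p]) * p ^ j) • (Y * Y)
      + ((p * (p ^ j * p ^ j) : ℤ_[p])) • (Y * Y * Y * W)), ?_⟩
    rw [add_assoc] at h2
    have h5 := eq_neg_of_add_eq_zero_left h2
    have h6 : Y = v • ((q : ℤ_[p]) • Y) := by rw [smul_smul, hv, one_smul]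
    refine (h6.trans (congrArg (v • ·) h5)).trans ?_
    generalize Y * Y * Y * W = T
    generalize Y * Y = S
    module

lemma aux_prime (p : ℕ) [Fact p.Prime] (hodd : Odd p) (n q : ℕ) (hq : q.Prime)
    (B : Matrix (Fin n) (Fin n) ℤ_[p]) (h : B ^ q = 1)
    (hB : B.map (PadicInt.toZMod : ℤ_[p] → ZMod p) = 1) : B = 1 := by
  have key : ∀ k : ℕ, ∃ Y : Matrix (Fin n) (Fin n) ℤ_[p], B = 1 + ((p : ℤ_[p]) ^ (k + 1)) • Y := by
    intro k
    induction k with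
    | zero =>
      have : ∀ i j, ∃ y, (B - 1) i j = (p : ℤ_[p]) * y := by
        intro i j
        have h1 : (B - 1) i j ∈ RingHom.ker (PadicInt.toZMod : ℤ_[p] →+* ZMod p) := by
          have := congrFun (congrFun hB i) j
          rw [Matrix.map_apply] at this
          rw [RingHom.mem_ker, Matrix.sub_apply, map_sub, this, Matrix.one_apply, Matrix.one_apply]
          split_ifs <;> simp
        rw [PadicInt.ker_toZMod, PadicInt.maximalIdeal_eq_span_p, Ideal.mem_span_singleton] at h1
        exact h1
      choose Y hY using this
      refine ⟨Matrix.of Y, ?_⟩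
      rw [← sub_eq_iff_eq_add']
      ext i j : 2
      simp [hY]
    | succ k ih =>
      obtain ⟨Y, hY⟩ := ih
      obtain ⟨Y', rfl⟩ := aux_step p hodd n q (k + 1) hq (by omega) Y (hY ▸ h)
      exact ⟨Y', by rw [hY, smul_smul, ← pow_succ]⟩
  rw [← sub_eq_zero]
  ext i j : 2
  by_contra hne
  have hf : FiniteMultiplicity (p : ℤ_[p]) ((B - 1) i j) :=
    FiniteMultiplicity.of_prime_left PadicInt.prime_p hne
  obtain ⟨k, hk⟩ := hf
  obtain ⟨Y, hY⟩ := key k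
  exact hk ⟨Y i j, by rw [hY]; simp⟩

lemma aux_fin (p : ℕ) [Fact p.Prime] (hodd : Odd p) (n m : ℕ) :
    m ≠ 0 → ∀ B : Matrix (Fin n) (Fin n) ℤ_[p], B ^ m = 1 →
    B.map (PadicInt.toZMod : ℤ_[p] → ZMod p) = 1 → B = 1 := by
  induction m using induction_on_primes with
  | zero => intro h; exact absurd rfl h
  | one => intro _ B h _; simpa using h
  | prime_mul q a hq ih =>
    intro hm B h hB
    refine aux_prime p hodd n q hq B (ih (right_ne_zero_of_mul hm) _ (by rw [← pow_mul, h]) ?_) hB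
    have := map_pow (PadicInt.toZMod : ℤ_[p] →+* ZMod p).mapMatrix B q
    simp only [RingHom.mapMatrix_apply] at this
    rw [this, hB, one_pow]

/-- For an odd prime `p`, the mod `p` reduction homomorphism
`GL_n(ℤ_p) → GL_n(F_p)` is injective on any finite subgroup `G` of `GL_n(ℤ_p)`;
equivalently, every matrix of finite order in `GL_n(ℤ_p)` that is congruent to the
identity matrix modulo `p` equals the identity matrix. -/
theorem finite_subgroup_mod_p_reduction_injective
    (p : ℕ) [Fact p.Prime] (hodd : Odd p) (n : ℕ)
    (G : Subgroup (GL (Fin n) ℤ_[p])) (hG : Finite G) :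
    Set.InjOn
        (fun g : GL (Fin n) ℤ_[p] =>
          ((g : Matrix (Fin n) (Fin n) ℤ_[p]).map (PadicInt.toZMod : ℤ_[p] → ZMod p)))
        (G : Set (GL (Fin n) ℤ_[p])) ∧
      ∀ A : GL (Fin n) ℤ_[p], IsOfFinOrder A →
        (A : Matrix (Fin n) (Fin n) ℤ_[p]).map (PadicInt.toZMod : ℤ_[p] → ZMod p) = 1 →
        A = 1 := by
  have main : ∀ A : GL (Fin n) ℤ_[p], IsOfFinOrder A →
        (A : Matrix (Fin n) (Fin n) ℤ_[p]).map (PadicInt.toZMod : ℤ_[p] → ZMod p) = 1 →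
        A = 1 := by
    intro A hA h
    obtain ⟨m, hm, hAm⟩ := isOfFinOrder_iff_pow_eq_one.1 hA
    apply Units.ext
    exact aux_fin p hodd n m hm.ne' _ (by rw [← Units.val_pow_eq_pow_val, hAm]; rfl) h
  refine ⟨?_, main⟩
  intro g hg h hh hgh
  have hmul := fun (a b : Matrix (Fin n) (Fin n) ℤ_[p]) =>
    map_mul (PadicInt.toZMod : ℤ_[p] →+* ZMod p).mapMatrix a b
  have hone := map_one ((PadicInt.toZMod : ℤ_[p] →+* ZMod p).mapMatrix (m := Fin n))
  simp only [RingHom.mapMatrix_apply] at hmul hone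
  have hfin : IsOfFinOrder (g⁻¹ * h) := by
    exact aux_sub G hG _ (G.mul_mem (G.inv_mem hg) hh)
  have := main (g⁻¹ * h) hfin (by
    rw [Units.val_mul, hmul]
    simp only at hgh
    rw [← hgh, ← hmul, ← Units.val_mul, inv_mul_cancel, Units.val_one, hone])
  exact inv_mul_eq_one.1 this
end

section
/- Let G be a finite subgroup of GL_n(ℤ_2) and let K be the kernel of the mod 2 reduction homomorphism GL_n(ℤ_2) → GL_n(F_2) restricted to G. Then K is an elementary abelian 2-group of rank at most n²: K is commutative, every element A of K satisfies A² = I, and the order of K is at most 2^(n²). -/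
open scoped MatrixGroups


theorem aux_unit {n : ℕ} (N : Matrix (Fin n) (Fin n) ℤ_[2])
    (h : (PadicInt.toZMod (p := 2)).mapMatrix N = 1) : IsUnit N := by
  rw [Matrix.isUnit_iff_isUnit_det]
  by_contra hd
  have h1 : N.det ∈ IsLocalRing.maximalIdeal ℤ_[2] := hd
  rw [← PadicInt.ker_toZMod, RingHom.mem_ker, RingHom.map_det, h, Matrix.det_one] at h1
  exact one_ne_zero h1

theorem aux_ker {n : ℕ} (N : Matrix (Fin n) (Fin n) ℤ_[2])
    (h : (PadicInt.toZMod (p := 2)).mapMatrix N = 0) : ∃ X, N = 2 * X := by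
  have : ∀ i j, ∃ x, N i j = 2 * x := by
    intro i j
    have h1 : PadicInt.toZMod (N i j) = 0 := congrFun (congrFun h i) j
    rw [← RingHom.mem_ker, PadicInt.ker_toZMod, PadicInt.maximalIdeal_eq_span_p,
      Ideal.mem_span_singleton] at h1
    obtain ⟨x, hx⟩ := h1
    exact ⟨x, by simpa using hx⟩
  choose f hf using this
  refine ⟨Matrix.of f, ?_⟩
  ext i j
  rw [hf i j, two_mul, two_mul]
  rfl

theorem aux_cancel {n : ℕ} (N : Matrix (Fin n) (Fin n) ℤ_[2]) (h : 2 * N = 0) : N = 0 := by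
  ext i j
  have h1 : (2 * N : Matrix (Fin n) (Fin n) ℤ_[2]) i j = 0 := by rw [h]; rfl
  rw [two_mul, Matrix.add_apply, ← two_mul] at h1
  simpa using h1

theorem aux_two {n : ℕ} (X : Matrix (Fin n) (Fin n) ℤ_[2]) :
    (PadicInt.toZMod (p := 2)).mapMatrix (2 * X) = 0 := by
  rw [two_mul, map_add]
  ext i j
  exact CharTwo.add_self_eq_zero _

theorem aux_torsion {n : ℕ} (m : ℕ) : ∀ (X M : Matrix (Fin n) (Fin n) ℤ_[2]), 0 < m →
    M = 1 + 4 * X → M ^ m = 1 → M = 1 := by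
  induction m using Nat.strong_induction_on with
  | _ m ih =>
    intro X M hm hM hMm
    have h4 : (4 : Matrix (Fin n) (Fin n) ℤ_[2]) = 2 * 2 := by norm_num
    rcases Nat.even_or_odd m with he | ho
    · obtain ⟨k, hk⟩ := he
      have h2 : M ^ 2 = 1 := by
        refine ih k (by omega) (2 * X + 4 * X ^ 2) (M ^ 2) (by omega) ?_ ?_
        · rw [hM]; noncomm_ring
        · rw [← pow_mul, ← hMm]; congr 1; omega
      have hu : IsUnit (1 + 2 * X) := aux_unit _ (by rw [map_add, aux_two]; simp)
      have h8 : 2 * (2 * (2 * (X * (1 + 2 * X)))) = 0 := by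
        have : M ^ 2 - 1 = 2 * (2 * (2 * (X * (1 + 2 * X)))) := by
          rw [hM]; noncomm_ring
        rw [← this, h2, sub_self]
      have h := aux_cancel _ (aux_cancel _ (aux_cancel _ h8))
      rw [hu.mul_left_eq_zero] at h
      rw [hM, h]; simp
    · have hφ : (PadicInt.toZMod (p := 2)).mapMatrix M = 1 := by
        rw [hM, h4, mul_assoc, map_add, aux_two]; simp
      have hu : IsUnit (∑ i ∈ Finset.range m, M ^ i) := by
        apply aux_unit
        rw [map_sum]
        simp only [map_pow, hφ, one_pow, Finset.sum_const, Finset.card_range]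
        obtain ⟨k, hk⟩ := ho
        have h1 : (m : ZMod 2) = 1 := (ZMod.natCast_eq_one_iff_odd).2 ⟨k, hk⟩
        rw [← Nat.cast_smul_eq_nsmul (ZMod 2), h1, one_smul]
      have h := mul_geom_sum M m
      rw [hMm, sub_self, hu.mul_left_eq_zero] at h
      exact sub_eq_zero.1 h

/-- Let `G` be a finite subgroup of `GL_n(ℤ_2)` and let `K` be the kernel of
the mod `2` reduction homomorphism `GL_n(ℤ_2) → GL_n(F_2)` restricted to `G`.  Then `K` is an
elementary abelian `2`-group of rank at most `n²`: `K` is commutative, every element `A` of `K`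
satisfies `A² = 1`, and the order of `K` is at most `2 ^ (n²)`. -/
theorem kernel_of_mod_two_reduction_elementary_abelian
    (n : ℕ) (G : Subgroup (GL (Fin n) ℤ_[2])) (hG : Finite G) :
    letI K : Set (GL (Fin n) ℤ_[2]) :=
      {g : GL (Fin n) ℤ_[2] | g ∈ G ∧
        (g : Matrix (Fin n) (Fin n) ℤ_[2]).map (PadicInt.toZMod : ℤ_[2] → ZMod 2) = 1}
    (∀ A ∈ K, ∀ B ∈ K, A * B = B * A) ∧
      (∀ A ∈ K, A ^ 2 = 1) ∧
      Nat.card K ≤ 2 ^ (n ^ 2) := by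
  have h4 : (4 : Matrix (Fin n) (Fin n) ℤ_[2]) = 2 * 2 := by norm_num
  set K : Set (GL (Fin n) ℤ_[2]) :=
      {g : GL (Fin n) ℤ_[2] | g ∈ G ∧
        (g : Matrix (Fin n) (Fin n) ℤ_[2]).map (PadicInt.toZMod : ℤ_[2] → ZMod 2) = 1} with hK
  have htor : ∀ A ∈ G, ∀ X : Matrix (Fin n) (Fin n) ℤ_[2],
      (A : Matrix (Fin n) (Fin n) ℤ_[2]) = 1 + 4 * X → A = 1 := by
    intro A hA X hX
    have hfin : IsOfFinOrder A :=
      Submonoid.isOfFinOrder_coe.2 (isOfFinOrder_of_finite (⟨A, hA⟩ : G))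
    have hp := hfin.orderOf_pos
    apply Units.ext
    refine aux_torsion (orderOf A) X _ hp hX ?_
    rw [← Units.val_pow_eq_pow_val, pow_orderOf_eq_one]; rfl
  have hX : ∀ A : K, ∃ X : Matrix (Fin n) (Fin n) ℤ_[2],
      ((A : GL (Fin n) ℤ_[2]) : Matrix (Fin n) (Fin n) ℤ_[2]) = 1 + 2 * X := by
    intro A
    have h : (PadicInt.toZMod (p := 2)).mapMatrix
        ((A : GL (Fin n) ℤ_[2]) : Matrix (Fin n) (Fin n) ℤ_[2]) = 1 := A.2.2
    obtain ⟨X, h⟩ := aux_ker (((A : GL (Fin n) ℤ_[2]) : Matrix (Fin n) (Fin n) ℤ_[2]) - 1)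
      (by rw [map_sub, h, map_one, sub_self])
    exact ⟨X, by rw [← h]; abel⟩
  have hsq : ∀ A ∈ K, A ^ 2 = 1 := by
    intro A hA
    obtain ⟨X, h⟩ := hX ⟨A, hA⟩
    refine htor _ (G.pow_mem hA.1 2) (X + X ^ 2) ?_
    rw [Units.val_pow_eq_pow_val, h]; noncomm_ring
  have hmul : ∀ A ∈ K, ∀ B ∈ K, A * B ∈ K := by
    intro A hA B hB
    refine ⟨G.mul_mem hA.1 hB.1, ?_⟩
    have h1 : (PadicInt.toZMod (p := 2)).mapMatrix (A : Matrix (Fin n) (Fin n) ℤ_[2]) = 1 := hA.2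
    have h2 : (PadicInt.toZMod (p := 2)).mapMatrix (B : Matrix (Fin n) (Fin n) ℤ_[2]) = 1 := hB.2
    change (PadicInt.toZMod (p := 2)).mapMatrix
      ((A * B : GL (Fin n) ℤ_[2]) : Matrix (Fin n) (Fin n) ℤ_[2]) = 1
    rw [Units.val_mul, map_mul, h1, h2, one_mul]
  have hinv : ∀ A ∈ K, A⁻¹ = A := fun A hA =>
    inv_eq_of_mul_eq_one_left (by rw [← pow_two]; exact hsq A hA)
  refine ⟨?_, hsq, ?_⟩
  · intro A hA B hB
    have := hinv _ (hmul A hA B hB)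
    rw [mul_inv_rev, hinv A hA, hinv B hB] at this
    exact this.symm
  · choose f hf using hX
    have hinj : Function.Injective
        (fun A : K => (PadicInt.toZMod (p := 2)).mapMatrix (f A)) := by
      intro A B hAB
      obtain ⟨Z, hZ⟩ := aux_ker (f A - f B) (by rw [map_sub]; exact sub_eq_zero.2 hAB)
      have hB2 : ((B : GL (Fin n) ℤ_[2]) : Matrix (Fin n) (Fin n) ℤ_[2]) *
          ((B : GL (Fin n) ℤ_[2]) : Matrix (Fin n) (Fin n) ℤ_[2]) = 1 := by
        rw [← Units.val_mul, ← pow_two, hsq B B.2]; rfl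
      have hA : ((A : GL (Fin n) ℤ_[2]) : Matrix (Fin n) (Fin n) ℤ_[2]) =
          ((B : GL (Fin n) ℤ_[2]) : Matrix (Fin n) (Fin n) ℤ_[2]) + 4 * Z := by
        rw [hf A, hf B, h4, mul_assoc, ← hZ]; noncomm_ring
      have h1 := htor (A * B) (G.mul_mem A.2.1 B.2.1)
        (Z * ((B : GL (Fin n) ℤ_[2]) : Matrix (Fin n) (Fin n) ℤ_[2]))
        (by rw [Units.val_mul, hA, add_mul, hB2, mul_assoc])
      apply Subtype.ext
      rw [eq_inv_of_mul_eq_one_left h1, hinv B B.2]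
    refine (Nat.card_le_card_of_injective _ hinj).trans ?_
    change Nat.card (Fin n → Fin n → ZMod 2) ≤ _
    simp [Nat.card_fun, pow_two, pow_mul]
end

section
/- Let K ⊆ K' be fields of characteristic zero and let W be a finite subgroup of GL_n(K) that is generated by reflections and acts irreducibly on K^n (the only W-invariant K-subspaces of K^n are 0 and K^n). Then the normalizer of the image of W in GL_n(K') is generated by the normalizer of W in GL_n(K) together with the nonzero scalar matrices: every g' ∈ GL_n(K') with g' W g'⁻¹ = W can be written as g' = λ g₁ where λ ∈ K'^× and g₁ ∈ GL_n(K) normalizes W. -/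
open scoped MatrixGroups

lemma aux_rank_one {n : ℕ} {K : Type*} [Field K] (M : Matrix (Fin n) (Fin n) K)
    (h : M.rank = 1) : ∃ a b : Fin n → K, M = Matrix.vecMulVec a b := by
  obtain ⟨⟨v, hv⟩, hv0, hs⟩ := finrank_eq_one_iff'.1 h
  have h2 : ∀ j, ∃ c : K, c • v = M.mulVec (Pi.single j 1) := by
    intro j
    obtain ⟨c, hc⟩ := hs ⟨M.mulVec (Pi.single j 1), ⟨Pi.single j 1, rfl⟩⟩
    exact ⟨c, congrArg Subtype.val hc⟩
  choose b hb using h2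
  refine ⟨v, b, ?_⟩
  ext i j
  have := congrFun (hb j) i
  simp at this
  rw [Matrix.vecMulVec_apply, mul_comm, this]

lemma aux_map_dual {n : ℕ} {K K' : Type*} [Field K] [Field K'] [Algebra K K']
    (f : Module.Dual K K') (G : Matrix (Fin n) (Fin n) K') (A B : Matrix (Fin n) (Fin n) K)
    (h : G * A.map (algebraMap K K') = B.map (algebraMap K K') * G) :
    G.map f * A = B * G.map f := by
  ext i j
  have := congrArg f (congrFun (congrFun h i) j)
  simp only [Matrix.mul_apply, Matrix.map_apply, map_sum] at this ⊢
  convert this using 2 with k _ k _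
  · rw [mul_comm (G i k), ← Algebra.smul_def, map_smul, smul_eq_mul, mul_comm]
  · rw [← Algebra.smul_def, map_smul, smul_eq_mul]

/-- Let `K ⊆ K'` be fields of characteristic zero and let `W` be a finite
subgroup of `GL_n(K)` that is generated by reflections and acts irreducibly on `K^n`.  Then the
normalizer of the image of `W` in `GL_n(K')` is generated by the normalizer of `W` in `GL_n(K)`
together with the nonzero scalar matrices: every `g' ∈ GL_n(K')` with `g' W g'⁻¹ = W` can be
written as `g' = λ g₁` where `λ ∈ K'^×` and `g₁ ∈ GL_n(K)` normalizes `W`. -/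
theorem normalizer_of_reflection_group_base_change
    (n : ℕ) (K K' : Type*) [Field K] [Field K'] [CharZero K] [CharZero K'] [Algebra K K']
    (W : Subgroup (GL (Fin n) K)) (hWfin : Finite W)
    (hrefl : Subgroup.closure
        {g : GL (Fin n) K | g ∈ W ∧
          ((1 : Matrix (Fin n) (Fin n) K) - (g : Matrix (Fin n) (Fin n) K)).rank = 1} = W)
    (hirr : ∀ V : Submodule K (Fin n → K),
      (∀ g ∈ W, ∀ v ∈ V, (g : Matrix (Fin n) (Fin n) K).mulVec v ∈ V) → V = ⊥ ∨ V = ⊤)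
    (g' : GL (Fin n) K')
    (hg' : (fun A : Matrix (Fin n) (Fin n) K' =>
            (g' : Matrix (Fin n) (Fin n) K') * A * ((g'⁻¹ : GL (Fin n) K') : Matrix (Fin n) (Fin n) K')) ''
          ((fun w : GL (Fin n) K =>
            (w : Matrix (Fin n) (Fin n) K).map (algebraMap K K')) '' (W : Set (GL (Fin n) K)))
        = (fun w : GL (Fin n) K =>
            (w : Matrix (Fin n) (Fin n) K).map (algebraMap K K')) '' (W : Set (GL (Fin n) K))) :
    ∃ (lam : K'ˣ) (g₁ : GL (Fin n) K), g₁ ∈ Subgroup.normalizer (W : Set (GL (Fin n) K)) ∧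
      (g' : Matrix (Fin n) (Fin n) K') =
        (lam : K') • ((g₁ : Matrix (Fin n) (Fin n) K).map (algebraMap K K')) := by
  have hG : ∀ A B : Matrix (Fin n) (Fin n) K',
      (g' : Matrix (Fin n) (Fin n) K') * A * ((g'⁻¹ : GL (Fin n) K') : Matrix (Fin n) (Fin n) K')
        = B → (g' : Matrix (Fin n) (Fin n) K') * A = B * (g' : Matrix (Fin n) (Fin n) K') := by
    intro A B h
    rw [← h, mul_assoc, ← Units.val_mul, inv_mul_cancel, Units.val_one, mul_one]
  have h1 : ∀ w ∈ W, ∃ w' ∈ W, (g' : Matrix (Fin n) (Fin n) K') *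
      (w : Matrix (Fin n) (Fin n) K).map (algebraMap K K') =
      (w' : Matrix (Fin n) (Fin n) K).map (algebraMap K K') * (g' : Matrix (Fin n) (Fin n) K') := by
    intro w hw
    obtain ⟨w', hw', h⟩ := hg'.le ⟨_, ⟨w, hw, rfl⟩, rfl⟩
    exact ⟨w', hw', hG _ _ h.symm⟩
  have h2 : ∀ w' ∈ W, ∃ w ∈ W, (g' : Matrix (Fin n) (Fin n) K') *
      (w : Matrix (Fin n) (Fin n) K).map (algebraMap K K') =
      (w' : Matrix (Fin n) (Fin n) K).map (algebraMap K K') * (g' : Matrix (Fin n) (Fin n) K') := by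
    intro w' hw'
    obtain ⟨_, ⟨w, hw, rfl⟩, h⟩ := hg'.ge ⟨w', hw', rfl⟩
    exact ⟨w, hw, hG _ _ h⟩
  rcases Nat.eq_zero_or_pos n with hn | hn
  · subst hn
    exact ⟨1, 1, one_mem _, Subsingleton.elim _ _⟩
  have : Nonempty (Fin n) := ⟨⟨0, hn⟩⟩
  set G : Matrix (Fin n) (Fin n) K' := (g' : Matrix (Fin n) (Fin n) K') with hGdef
  have hGne : G ≠ 0 := g'.ne_zero
  obtain ⟨i₀, j₀, hij⟩ : ∃ i j, G i j ≠ 0 := by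
    by_contra! hc
    exact hGne (Matrix.ext hc)
  obtain ⟨f, hf⟩ : ∃ f : Module.Dual K K', f (G i₀ j₀) ≠ 0 := by
    by_contra! hc
    exact hij ((Module.forall_dual_apply_eq_zero_iff K _).1 hc)
  set X : Matrix (Fin n) (Fin n) K := G.map f with hX
  have hXne : X ≠ 0 := fun h => hf (by simpa [hX] using congrFun (congrFun h i₀) j₀)
  have hker : LinearMap.ker X.mulVecLin = ⊥ := by
    refine (hirr (LinearMap.ker X.mulVecLin) ?_).resolve_right ?_
    · intro w hw v hv
      obtain ⟨w', hw', h⟩ := h1 w hw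
      have := aux_map_dual f G _ _ h
      simp only [LinearMap.mem_ker, Matrix.mulVecLin_apply] at hv ⊢
      rw [Matrix.mulVec_mulVec, ← hX] at *
      rw [this, ← Matrix.mulVec_mulVec, hv, Matrix.mulVec_zero]
    · intro h
      apply hXne
      rw [LinearMap.ker_eq_top] at h
      ext i j
      have := congrFun (LinearMap.congr_fun h (Pi.single j 1)) i
      simpa using this
  have hXu : IsUnit X := Matrix.mulVec_injective_iff_isUnit.1 (LinearMap.ker_eq_bot.1 hker)
  obtain ⟨g₁, hg₁⟩ := hXu
  set φ := (algebraMap K K').mapMatrix (m := Fin n) with hφ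
  have hφm : ∀ M : Matrix (Fin n) (Fin n) K, M.map (algebraMap K K') = φ M := fun _ => rfl
  -- an eigenvector
  obtain ⟨v, hv0, μ, hv⟩ : ∃ v : Fin n → K, v ≠ 0 ∧ ∃ μ : K', G.mulVec (algebraMap K K' ∘ v) =
      μ • (φ X).mulVec (algebraMap K K' ∘ v) := by
    by_cases hs : ∃ s ∈ W, ((1 : Matrix (Fin n) (Fin n) K) - (s : Matrix (Fin n) (Fin n) K)).rank = 1
    · obtain ⟨s, hs, hr⟩ := hs
      obtain ⟨a, b, hab⟩ := aux_rank_one _ hr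
      have hab0 : a ≠ 0 ∧ b ≠ 0 := by
        constructor <;> rintro rfl <;> simp [hab] at hr
      obtain ⟨j, hj⟩ := Function.ne_iff.1 hab0.2
      obtain ⟨s', hs', h⟩ := h1 s hs
      have hX2 := aux_map_dual f G _ _ h
      rw [← hX] at hX2
      rw [hφm, hφm] at h
      have hP : G * φ (1 - s) = φ (1 - s') * G := by
        rw [map_sub, map_sub, mul_sub, sub_mul, h]; simp
      have hQ : X * (1 - s) = (1 - s') * X := by
        rw [mul_sub, sub_mul, hX2]; simp
      have hQ' : (1 - s' : Matrix (Fin n) (Fin n) K) = X * (1 - s) * (g₁⁻¹ : GL (Fin n) K) := by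
        rw [hQ, ← hg₁, mul_assoc, ← Units.val_mul, mul_inv_cancel, Units.val_one, mul_one]
      have hφv : φ (Matrix.vecMulVec a b) =
          Matrix.vecMulVec (algebraMap K K' ∘ a) (algebraMap K K' ∘ b) := by
        ext i j; simp [hφ, Matrix.vecMulVec_apply]
      rw [hQ', hab, map_mul, map_mul, hφv, Matrix.mul_vecMulVec, Matrix.mul_vecMulVec,
        Matrix.vecMulVec_mul, Matrix.vecMulVec_mul] at hP
      have hj' : algebraMap K K' (b j) ≠ 0 := by simpa using hj
      refine ⟨a, hab0.1, Matrix.vecMul (Matrix.vecMul (algebraMap K K' ∘ b)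
        (φ (g₁⁻¹ : GL (Fin n) K))) G j / algebraMap K K' (b j), ?_⟩
      ext i
      have := congrFun (congrFun hP i) j
      simp only [Matrix.vecMulVec_apply, Function.comp_apply] at this
      rw [Pi.smul_apply, smul_eq_mul, div_mul_eq_mul_div, eq_div_iff hj', this, mul_comm]
    · have hW : ∀ w ∈ W, w = 1 := by
        intro w hw
        rw [← hrefl] at hw
        have : {g : GL (Fin n) K | g ∈ W ∧
          ((1 : Matrix (Fin n) (Fin n) K) - (g : Matrix (Fin n) (Fin n) K)).rank = 1} = ∅ := by
          ext g
          simp only [Set.mem_setOf_eq, Set.mem_empty_iff_false, iff_false]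
          exact fun h => hs ⟨g, h⟩
        rw [this, Subgroup.closure_empty] at hw
        simpa using hw
      have htop : Submodule.span K {(Pi.single i₀ 1 : Fin n → K)} = ⊤ := by
        refine (hirr _ ?_).resolve_left ?_
        · intro w hw v hv
          rw [hW w hw]
          simpa using hv
        · simp
      have hsub : ∀ j, j = i₀ := by
        intro j
        by_contra hj
        have : (Pi.single j 1 : Fin n → K) ∈ Submodule.span K {(Pi.single i₀ 1 : Fin n → K)} := by
          rw [htop]; trivial
        obtain ⟨c, hc⟩ := Submodule.mem_span_singleton.1 this
        have := congrFun hc j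
        simp [hj] at this
      have hj0 := hsub j₀
      have hf' : algebraMap K K' (f (G i₀ i₀)) ≠ 0 := by
        rw [hj0] at hf; simpa using hf
      refine ⟨Pi.single i₀ 1, by simp, G i₀ i₀ / algebraMap K K' (f (G i₀ i₀)), ?_⟩
      have hsing : (algebraMap K K' ∘ (Pi.single i₀ 1 : Fin n → K)) = Pi.single i₀ 1 := by
        ext j; rw [hsub j]; simp
      ext i
      rw [hsub i, hsing]
      simp [hφ, hX]
      field_simp
  -- the eigenspace is everything
  let S : Submodule K (Fin n → K) :=
    { carrier := {u | G.mulVec (algebraMap K K' ∘ u) = μ • (φ X).mulVec (algebraMap K K' ∘ u)}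
      zero_mem' := by
        have : (algebraMap K K' ∘ (0 : Fin n → K)) = 0 := by ext; simp
        simp [this]
      add_mem' := by
        intro u u' hu hu'
        have : (algebraMap K K' ∘ (u + u')) = algebraMap K K' ∘ u + algebraMap K K' ∘ u' := by
          ext; simp
        simp only [Set.mem_setOf_eq] at *
        rw [this, Matrix.mulVec_add, Matrix.mulVec_add, hu, hu', smul_add]
      smul_mem' := by
        intro c u hu
        have : (algebraMap K K' ∘ (c • u)) = algebraMap K K' c • (algebraMap K K' ∘ u) := by
          ext; simp
        simp only [Set.mem_setOf_eq] at *
        rw [this, Matrix.mulVec_smul, Matrix.mulVec_smul, hu, smul_comm] }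
  have hS : S = ⊤ := by
    refine (hirr S ?_).resolve_left ?_
    · intro w hw u hu
      obtain ⟨w', hw', h⟩ := h1 w hw
      have hX2 := aux_map_dual f G _ _ h
      rw [← hX] at hX2
      rw [hφm, hφm] at h
      change G.mulVec _ = μ • (φ X).mulVec _ at hu
      change G.mulVec _ = μ • (φ X).mulVec _
      have hc : (algebraMap K K' ∘ ((w : Matrix (Fin n) (Fin n) K).mulVec u)) =
          (φ w).mulVec (algebraMap K K' ∘ u) := by
        ext i
        exact RingHom.map_mulVec _ _ _ _
      rw [hc, Matrix.mulVec_mulVec, Matrix.mulVec_mulVec, h, ← map_mul, hX2, map_mul,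
        ← Matrix.mulVec_mulVec, ← Matrix.mulVec_mulVec, hu, Matrix.mulVec_smul]
    · intro h
      have : v ∈ S := hv
      rw [h] at this
      exact hv0 (by simpa using this)
  have hGX : G = μ • φ X := by
    ext i j
    have : (Pi.single j 1 : Fin n → K) ∈ S := by rw [hS]; trivial
    change G.mulVec _ = μ • (φ X).mulVec _ at this
    have hsing : (algebraMap K K' ∘ (Pi.single j 1 : Fin n → K)) = Pi.single j 1 := by
      ext k
      by_cases hk : k = j
      · subst hk; simp
      · simp [hk]
    rw [hsing] at this
    simpa using congrFun this i
  have hμ : μ ≠ 0 := by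
    rintro rfl
    exact hGne (by simpa using hGX)
  refine ⟨Units.mk0 μ hμ, g₁, ?_, ?_⟩
  · rw [Subgroup.mem_normalizer_iff]
    intro w
    constructor
    · intro hw
      obtain ⟨w', hw', h⟩ := h1 w hw
      have hX2 := aux_map_dual f G _ _ h
      rw [← hX, ← hg₁, ← Units.val_mul, ← Units.val_mul] at hX2
      rw [Units.ext hX2, mul_inv_cancel_right]
      exact hw'
    · intro hw
      obtain ⟨w₂, hw₂, h⟩ := h2 _ hw
      have hX2 := aux_map_dual f G _ _ h
      rw [← hX, ← hg₁, ← Units.val_mul, ← Units.val_mul] at hX2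
      have := Units.ext hX2
      rw [inv_mul_cancel_right] at this
      rw [← mul_left_cancel this]
      exact hw₂
  · rw [hg₁]
    exact hGX
end

section
/- Let p be a prime and m ≥ 3 an integer with p ≡ 1 (mod m) or p ≡ −1 (mod m). Let ζ be a primitive m-th root of unity in an algebraic closure of ℚ_p, and suppose x ∈ ℤ_p is an element whose image in the algebraic closure under the canonical embedding equals ζ + ζ⁻¹. Then 2 + x is a unit in ℤ_p. -/
/-- Let `p` be a prime and `m ≥ 3` an integer with `p ≡ ±1 (mod m)`.
Let `ζ` be a primitive `m`-th root of unity in an algebraic closure of `ℚ_p`, and suppose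
`x ∈ ℤ_p` is an element whose image in the algebraic closure under the canonical embedding
equals `ζ + ζ⁻¹`.  Then `2 + x` is a unit in `ℤ_p`. -/
theorem two_add_zeta_add_zeta_inv_isUnit
    (p m : ℕ) [Fact p.Prime] (hm : 3 ≤ m)
    (hpm : (p : ZMod m) = 1 ∨ (p : ZMod m) = -1)
    (ζ : AlgebraicClosure ℚ_[p]) (hζ : IsPrimitiveRoot ζ m)
    (x : ℤ_[p])
    (hx : algebraMap ℚ_[p] (AlgebraicClosure ℚ_[p]) (x : ℚ_[p]) = ζ + ζ⁻¹) :
    IsUnit ((2 : ℤ_[p]) + x) := by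
  by_contra hu
  have hcop : p.Coprime m := by
    rw [← ZMod.isUnit_iff_coprime]
    rcases hpm with h | h <;> rw [h]
    · exact isUnit_one
    · exact isUnit_one.neg
  have hmu : IsUnit (m : ℤ_[p]) := by
    rw [PadicInt.isUnit_iff]
    by_contra h
    have h1 : ‖((m : ℤ) : ℤ_[p])‖ < 1 := by
      rw [Int.cast_natCast]
      exact lt_of_le_of_ne (PadicInt.norm_le_one _) h
    rw [PadicInt.norm_int_lt_one_iff_dvd] at h1
    have h2 : p ∣ m := by exact_mod_cast h1
    have := Nat.Coprime.eq_one_of_dvd hcop h2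
    exact (Fact.out : p.Prime).one_lt.ne' this
  have hint : IsIntegral ℤ_[p] ζ := hζ.isIntegral (by omega) |>.tower_top
  let R := integralClosure ℤ_[p] (AlgebraicClosure ℚ_[p])
  let z : R := ⟨ζ, hint⟩
  obtain ⟨M, hM, hcomap⟩ := Ideal.exists_ideal_over_maximal_of_isIntegral (S := R)
    (IsLocalRing.maximalIdeal ℤ_[p]) (IsLocalRing.le_maximalIdeal (RingHom.ker_ne_top _))
  have h0 : ζ ≠ 0 := hζ.ne_zero (by omega)
  have hxR : (z + 1) ^ 2 = z * algebraMap ℤ_[p] R (2 + x) := by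
    apply Subtype.ext
    have : algebraMap ℤ_[p] (AlgebraicClosure ℚ_[p]) x = ζ + ζ⁻¹ := hx
    change (ζ + 1) ^ 2 = ζ * algebraMap ℤ_[p] (AlgebraicClosure ℚ_[p]) (2 + x)
    rw [map_add, this, map_ofNat]
    field_simp
    ring
  have hmem : algebraMap ℤ_[p] R (2 + x) ∈ M := by
    rw [← Ideal.mem_comap, hcomap]
    exact hu
  have hz1 : z + 1 ∈ M := by
    apply hM.isPrime.mem_of_pow_mem 2
    rw [hxR]
    exact M.mul_mem_left _ hmem
  have hsum : ∑ i ∈ Finset.range m, (z ^ 2) ^ i = 0 := by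
    have h2 : z ^ 2 - 1 ≠ 0 := by
      intro h
      have h3 : ζ ^ 2 = 1 := by
        have := congrArg (Subtype.val) (sub_eq_zero.1 h)
        exact this
      have := Nat.le_of_dvd (by norm_num) (hζ.dvd_of_pow_eq_one 2 h3)
      omega
    have h4 := geom_sum_mul (z ^ 2) m
    have h5 : z ^ m = 1 := Subtype.ext hζ.pow_eq_one
    rw [← pow_mul, mul_comm 2 m, pow_mul, h5, one_pow, sub_self] at h4
    exact (mul_eq_zero.1 h4).resolve_right h2
  have hmM : (m : R) ∈ M := by
    rw [← Ideal.Quotient.eq_zero_iff_mem] at hz1 ⊢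
    have h6 := congrArg (Ideal.Quotient.mk M) hsum
    rw [map_add, map_one] at hz1
    have h7 := eq_neg_of_add_eq_zero_left hz1
    simpa [h7] using h6
  apply (IsLocalRing.mem_maximalIdeal (m : ℤ_[p])).1 _ hmu
  rw [← hcomap, Ideal.mem_comap, map_natCast]
  exact hmM
end

section
/- Let N be a group and A an abelian normal subgroup of N with quotient homomorphism π : N → W := N/A, and suppose the conjugation action of W on A is faithful (equivalently, the centralizer of A in N equals A). Then the assignment sending a derivation s : W → A to the map x ↦ s(π(x))·x is a group isomorphism from the group of derivations (under pointwise multiplication) onto the group of those automorphisms of N which restrict to the identity on A. Moreover, under the same hypotheses, the center of N equals the set of elements a ∈ A satisfying n a n⁻¹ = a for all n ∈ N. -/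
/-- Let `N` be a group and `A` an abelian normal subgroup of `N` with quotient
homomorphism `π : N → W := N/A`, and suppose the conjugation action of `W` on `A` is faithful
(equivalently, the centralizer of `A` in `N` equals `A`).  Then the assignment sending a
derivation `s : W → A` to the map `x ↦ s(π(x))·x` is a group isomorphism from the group of
derivations (under pointwise multiplication) onto the group of those automorphisms of `N` which
restrict to the identity on `A`.  Moreover, under the same hypotheses, the center of `N` equals
the set of elements `a ∈ A` satisfying `n a n⁻¹ = a` for all `n ∈ N`. -/
theorem derivations_equiv_automorphisms_fixing_abelian_normal_subgroup
    (N : Type*) [Group N] (A : Subgroup N) (hnorm : A.Normal)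
    (hcomm : ∀ a ∈ A, ∀ b ∈ A, a * b = b * a)
    (hfaith : Subgroup.centralizer (A : Set N) = A) :
    letI Der : Set ((N ⧸ A) → N) :=
      {s : (N ⧸ A) → N |
        (∀ w : N ⧸ A, s w ∈ A) ∧
        ∀ n₁ n₂ : N, s (QuotientGroup.mk (n₁ * n₂)) =
          s (QuotientGroup.mk n₁) * (n₁ * s (QuotientGroup.mk n₂) * n₁⁻¹)}
    letI Φ : ((N ⧸ A) → N) → (N → N) := fun s x => s (QuotientGroup.mk x) * x
    -- each derivation yields an automorphism of `N` restricting to the identity on `A`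
    (∀ s ∈ Der, Function.Bijective (Φ s) ∧
        (∀ x y : N, Φ s (x * y) = Φ s x * Φ s y) ∧ (∀ a ∈ A, Φ s a = a)) ∧
      -- the assignment is injective
      (∀ s ∈ Der, ∀ t ∈ Der, Φ s = Φ t → s = t) ∧
      -- the assignment is surjective onto the automorphisms restricting to the identity on `A`
      (∀ φ : N ≃* N, (∀ a ∈ A, φ a = a) → ∃ s ∈ Der, ∀ x : N, φ x = Φ s x) ∧
      -- the assignment is a group homomorphism (pointwise product ↦ composition)
      (∀ s ∈ Der, ∀ t ∈ Der, Φ (s * t) = Φ s ∘ Φ t) ∧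
      -- the center of `N` is the set of `N`-invariant elements of `A`
      (∀ x : N, x ∈ Subgroup.center N ↔ x ∈ A ∧ ∀ n : N, n * x * n⁻¹ = x) := by
  have hmk : ∀ a ∈ A, ∀ x : N, (QuotientGroup.mk (a * x) : N ⧸ A) = QuotientGroup.mk x := by
    intro a ha x
    rw [QuotientGroup.eq]
    have h := hnorm.conj_mem _ (A.inv_mem ha) x⁻¹
    simpa [mul_assoc] using h
  refine ⟨?_, ?_, ?_, ?_, ?_⟩
  · rintro s ⟨hs, hd⟩
    have h1 : s (QuotientGroup.mk 1) = 1 := by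
      have h := hd 1 1
      simpa using h
    refine ⟨⟨?_, ?_⟩, ?_, ?_⟩
    · intro x y hxy
      have hxy' : s (QuotientGroup.mk x) * x = s (QuotientGroup.mk y) * y := hxy
      have e : (QuotientGroup.mk x : N ⧸ A) = QuotientGroup.mk y := by
        rw [← hmk _ (hs (QuotientGroup.mk x)) x, hxy', hmk _ (hs _)]
      rw [e] at hxy'
      exact mul_left_cancel hxy'
    · intro y
      refine ⟨(s (QuotientGroup.mk y))⁻¹ * y, ?_⟩
      show s (QuotientGroup.mk ((s (QuotientGroup.mk y))⁻¹ * y)) * _ = y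
      rw [hmk _ (A.inv_mem (hs _))]
      group
    · intro x y
      show s (QuotientGroup.mk (x * y)) * (x * y) =
        s (QuotientGroup.mk x) * x * (s (QuotientGroup.mk y) * y)
      rw [hd]
      group
    · intro a ha
      show s (QuotientGroup.mk a) * a = a
      have h := hmk a ha 1
      rw [mul_one] at h
      rw [h, h1, one_mul]
  · intro s _ t _ h
    funext w
    induction w using QuotientGroup.induction_on with
    | H x => exact mul_right_cancel (congrFun h x)
  · intro φ hφ
    have hg : ∀ x : N, φ x * x⁻¹ ∈ A := by
      intro x
      rw [← hfaith, Subgroup.mem_centralizer_iff]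
      intro a ha
      have h := hφ _ (hnorm.conj_mem a ha x⁻¹)
      rw [map_mul, map_mul, hφ a ha, map_inv, map_inv, map_inv, inv_inv, inv_inv] at h
      have h2 : a * φ x = φ x * (x⁻¹ * a * x) := by rw [← h]; group
      rw [← mul_assoc, h2]
      group
    have hc : ∀ x y : N, (QuotientGroup.mk x : N ⧸ A) = QuotientGroup.mk y →
        φ x * x⁻¹ = φ y * y⁻¹ := by
      intro x y h
      have h' := hφ _ (QuotientGroup.eq.1 h)
      rw [map_mul, map_inv] at h'
      have h2 : φ y = φ x * (x⁻¹ * y) := by rw [← h']; group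
      rw [h2]
      group
    have hs : ∀ x : N, φ (Quotient.out (QuotientGroup.mk x : N ⧸ A)) *
        (Quotient.out (QuotientGroup.mk x : N ⧸ A))⁻¹ = φ x * x⁻¹ :=
      fun x => hc _ _ (QuotientGroup.out_eq' _)
    refine ⟨fun w => φ (Quotient.out w) * (Quotient.out w)⁻¹, ⟨fun w => hg _, ?_⟩, ?_⟩
    · intro x y
      show φ (Quotient.out (QuotientGroup.mk (x * y) : N ⧸ A)) *
        (Quotient.out (QuotientGroup.mk (x * y) : N ⧸ A))⁻¹ = (_ * _) * (x * (_ * _) * x⁻¹)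
      rw [hs, hs, hs, map_mul]
      group
    · intro x
      show φ x = φ (Quotient.out (QuotientGroup.mk x : N ⧸ A)) *
        (Quotient.out (QuotientGroup.mk x : N ⧸ A))⁻¹ * x
      rw [hs]
      group
  · rintro s ⟨hs, _⟩ t ⟨ht, _⟩
    funext x
    show s (QuotientGroup.mk x) * t (QuotientGroup.mk x) * x =
      s (QuotientGroup.mk (t (QuotientGroup.mk x) * x)) * (t (QuotientGroup.mk x) * x)
    rw [hmk _ (ht _), mul_assoc]
  · intro x
    rw [Subgroup.mem_center_iff]
    constructor
    · intro h
      refine ⟨?_, fun n => by rw [h n]; group⟩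
      rw [← hfaith, Subgroup.mem_centralizer_iff]
      exact fun a _ => h a
    · rintro ⟨_, h⟩ n
      exact mul_inv_eq_iff_eq_mul.1 (h n)
end

section
/- Let p be a prime, G a group, and g₁, g₂ ∈ G elements such that the commutator z := g₁g₂g₁⁻¹g₂⁻¹ is central in G and has order exactly p. Let Z be a subgroup of the center of G, let h ∈ G, and let a, b, c, d be integers such that h g₁ h⁻¹ ∈ g₁^a g₂^c Z and h g₂ h⁻¹ ∈ g₁^b g₂^d Z. Then ad − bc ≡ 1 (mod p). -/
namespace CommAux

def R {G : Type*} [Group G] (z x y : G) (n : ℤ) : Prop := x * y = z ^ n * (y * x)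

variable {G : Type*} [Group G] {z : G}

lemma cz (hz : z ∈ Subgroup.center G) (n : ℤ) (x : G) : x * z ^ n = z ^ n * x :=
  Subgroup.mem_center_iff.1 (Subgroup.zpow_mem _ hz n) x

lemma R.symm {x y : G} {n : ℤ} (h : R z x y n) : R z y x (-n) := by
  unfold R at *
  rw [h, ← mul_assoc, ← zpow_add]; simp

lemma R.mul_right (hz : z ∈ Subgroup.center G) {x y y' : G} {n m : ℤ} (h : R z x y n)
    (h' : R z x y' m) : R z x (y * y') (n + m) := by
  unfold R at *
  calc x * (y * y') = (x * y) * y' := by group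
    _ = z ^ n * (y * (x * y')) := by rw [h]; group
    _ = z ^ n * ((y * z ^ m) * (y' * x)) := by rw [h']; simp only [mul_assoc]
    _ = _ := by rw [cz hz, zpow_add]; simp only [mul_assoc]

lemma R.mul_left (hz : z ∈ Subgroup.center G) {x x' y : G} {n m : ℤ} (h : R z x y n)
    (h' : R z x' y m) : R z (x * x') y (n + m) := by
  have := (h.symm.mul_right hz h'.symm).symm
  rwa [show -(-n + -m) = n + m by ring] at this

lemma R.zpow_right (hz : z ∈ Subgroup.center G) {x y : G} {n : ℤ} (h : R z x y n) (k : ℤ) :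
    R z x (y ^ k) (n * k) := by
  have h1 : SemiconjBy x y (z ^ n * y) := by
    unfold R at h
    unfold SemiconjBy
    rw [h, mul_assoc]
  have h2 := h1.zpow_right k
  have h3 : Commute (z ^ n) y := (cz hz n y).symm
  rw [h3.mul_zpow, ← zpow_mul] at h2
  unfold R
  rw [h2.eq, mul_assoc]

lemma R.zpow_left (hz : z ∈ Subgroup.center G) {x y : G} {n : ℤ} (h : R z x y n) (k : ℤ) :
    R z (x ^ k) y (n * k) := by
  have := (h.symm.zpow_right hz k).symm
  rwa [show -(-n * k) = n * k by ring] at this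

lemma R.central {x u : G} (hu : u ∈ Subgroup.center G) : R z x u 0 := by
  unfold R
  rw [Subgroup.mem_center_iff.1 hu x]; simp

lemma R.self (x : G) : R z x x 0 := by
  unfold R
  simp

end CommAux

/-- Let `p` be a prime, `G` a group, and `g₁, g₂ ∈ G` elements such that the
commutator `z := g₁g₂g₁⁻¹g₂⁻¹` is central in `G` and has order exactly `p` (`z^p = 1`, `z ≠ 1`).
Let `Z` be a subgroup of the center of `G`, let `h ∈ G`, and let `a, b, c, d` be integers such
that `h g₁ h⁻¹ ∈ g₁^a g₂^c Z` and `h g₂ h⁻¹ ∈ g₁^b g₂^d Z`.  Then `ad − bc ≡ 1 (mod p)`. -/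
theorem commutator_conjugation_det_one_mod_p
    (p : ℕ) (hp : p.Prime) (G : Type*) [Group G] (g₁ g₂ : G)
    (z : G) (hz : z = g₁ * g₂ * g₁⁻¹ * g₂⁻¹)
    (hzc : z ∈ Subgroup.center G) (hzp : z ^ p = 1) (hz1 : z ≠ 1)
    (Z : Subgroup G) (hZ : Z ≤ Subgroup.center G)
    (h : G) (a b c d : ℤ)
    (h₁ : ∃ u ∈ Z, h * g₁ * h⁻¹ = g₁ ^ a * g₂ ^ c * u)
    (h₂ : ∃ u ∈ Z, h * g₂ * h⁻¹ = g₁ ^ b * g₂ ^ d * u) :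
    a * d - b * c ≡ 1 [ZMOD (p : ℤ)] := by
  obtain ⟨u, hu, hX⟩ := h₁
  obtain ⟨v, hv, hY⟩ := h₂
  have r : CommAux.R z g₁ g₂ 1 := by
    unfold CommAux.R
    rw [hz]; group
  have rconj : CommAux.R z (h * g₁ * h⁻¹) (h * g₂ * h⁻¹) 1 := by
    unfold CommAux.R at *
    calc h * g₁ * h⁻¹ * (h * g₂ * h⁻¹) = h * (g₁ * g₂) * h⁻¹ := by group
      _ = (h * z ^ (1 : ℤ)) * (g₂ * g₁) * h⁻¹ := by rw [r]; simp only [mul_assoc]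
      _ = _ := by rw [CommAux.cz hzc]; group
  rw [hX, hY] at rconj
  have e1 : CommAux.R z g₁ (g₁ ^ b * g₂ ^ d * v) _ :=
    (((CommAux.R.self g₁).zpow_right hzc b).mul_right hzc (r.zpow_right hzc d)).mul_right hzc
      (CommAux.R.central (hZ hv))
  have e2 : CommAux.R z g₂ (g₁ ^ b * g₂ ^ d * v) _ :=
    ((r.symm.zpow_right hzc b).mul_right hzc
      ((CommAux.R.self g₂).zpow_right hzc d)).mul_right hzc (CommAux.R.central (hZ hv))
  have e3 : CommAux.R z u (g₁ ^ b * g₂ ^ d * v) _ := (CommAux.R.central (hZ hu)).symm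
  have e := ((e1.zpow_left hzc a).mul_left hzc (e2.zpow_left hzc c)).mul_left hzc e3
  unfold CommAux.R at e rconj
  rw [rconj] at e
  have e' := mul_right_cancel e
  have ho : orderOf z = p := by
    haveI := Fact.mk hp
    exact orderOf_eq_prime hzp hz1
  rw [zpow_eq_zpow_iff_modEq, ho] at e'
  refine Int.ModEq.trans (congrArg (· % (p:ℤ)) ?_) e'.symm
  ring
end

section
/- Let p be a prime, n ≥ 3 an integer, and θ a nonzero element of F_p with θ ≠ 1. Let H be a subgroup of GL_n(F_p) containing all n × n permutation matrices as well as the diagonal matrix diag(θ, θ⁻¹, 1, …, 1). Then the natural action of H on the column space F_p^n is irreducible: the only H-invariant F_p-subspaces of F_p^n are 0 and F_p^n. -/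
open scoped MatrixGroups

/-- Let `p` be a prime, `n ≥ 3`, and `θ` a nonzero element of `F_p` with
`θ ≠ 1`.  Let `H` be a subgroup of `GL_n(F_p)` containing all `n × n` permutation matrices as
well as the diagonal matrix `diag(θ, θ⁻¹, 1, …, 1)`.  Then the natural action of `H` on the
column space `F_p^n` is irreducible: the only `H`-invariant subspaces of `F_p^n` are `0` and
`F_p^n`. -/
theorem subgroup_with_permutations_and_diag_irreducible
    (p : ℕ) [Fact p.Prime] (n : ℕ) (hn : 3 ≤ n)
    (θ : ZMod p) (hθ0 : θ ≠ 0) (hθ1 : θ ≠ 1)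
    (H : Subgroup (GL (Fin n) (ZMod p)))
    (hperm : ∀ σ : Equiv.Perm (Fin n), ∃ g ∈ H,
      (g : Matrix (Fin n) (Fin n) (ZMod p)) =
        Matrix.of (fun i j : Fin n => if i = σ j then (1 : ZMod p) else 0))
    (hdiag : ∃ g ∈ H,
      (g : Matrix (Fin n) (Fin n) (ZMod p)) =
        Matrix.diagonal (fun i : Fin n =>
          if i = (⟨0, by omega⟩ : Fin n) then θ
          else if i = (⟨1, by omega⟩ : Fin n) then θ⁻¹ else 1)) :
    ∀ V : Submodule (ZMod p) (Fin n → ZMod p),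
      (∀ g ∈ H, ∀ v ∈ V, (g : Matrix (Fin n) (Fin n) (ZMod p)).mulVec v ∈ V) →
      V = ⊥ ∨ V = ⊤ := by
  intro V hV
  have hP : ∀ (σ : Equiv.Perm (Fin n)) (v : Fin n → ZMod p), v ∈ V →
      (fun i => v (σ i)) ∈ V := by
    intro σ v hv
    obtain ⟨g, hg, he⟩ := hperm σ.symm
    have h := hV g hg v hv
    rw [he] at h
    convert h using 1
    funext i
    simp [Matrix.mulVec, dotProduct, Equiv.eq_symm_apply]
  obtain ⟨g, hg, he⟩ := hdiag
  set a : Fin n := ⟨0, by omega⟩ with ha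
  set b : Fin n := ⟨1, by omega⟩ with hb
  obtain ⟨c, hc⟩ : ∃ c : Fin n, c = ⟨2, by omega⟩ := ⟨_, rfl⟩
  have hab : a ≠ b := by simp [ha, hb]
  have hac : a ≠ c := by simp [ha, hc]
  have hbc : b ≠ c := by simp [hb, hc]
  have hD : ∀ v : Fin n → ZMod p, v ∈ V →
      (fun i => (if i = a then θ - 1 else if i = b then θ⁻¹ - 1 else 0) * v i) ∈ V := by
    intro v hv
    have h := V.sub_mem (hV g hg v hv) hv
    rw [he] at h
    convert h using 1
    funext i
    simp only [Pi.sub_apply, Matrix.mulVec_diagonal]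
    split_ifs <;> ring
  have hθ : θ - 1 ≠ 0 := sub_ne_zero.mpr hθ1
  by_cases hbot : V = ⊥
  · exact Or.inl hbot
  right
  obtain ⟨v, hv, hv0⟩ := (Submodule.ne_bot_iff V).mp hbot
  obtain ⟨k, hk⟩ := Function.ne_iff.mp hv0
  have h4 := hD _ (hP (Equiv.swap b c) _ (hD _ (hP (Equiv.swap a k) v hv)))
  have h5 := V.smul_mem ((θ - 1) * ((θ - 1) * v k))⁻¹ h4
  have hne : (θ - 1) * ((θ - 1) * v k) ≠ 0 := mul_ne_zero hθ (mul_ne_zero hθ hk)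
  have hea : (Pi.single a 1 : Fin n → ZMod p) ∈ V := by
    convert h5 using 1
    funext i
    by_cases hia : i = a
    · subst hia
      simp only [Pi.smul_apply, smul_eq_mul, Pi.single_eq_same, if_true,
        Equiv.swap_apply_of_ne_of_ne hab hac, Equiv.swap_apply_left]
      exact (inv_mul_cancel₀ hne).symm
    · by_cases hib : i = b
      · subst hib
        simp [hab.symm, hac.symm, hbc.symm]
      · simp [hia, hib]
  rw [eq_top_iff]
  intro x _
  rw [pi_eq_sum_univ x]
  refine V.sum_mem fun i _ => V.smul_mem _ ?_
  convert hP (Equiv.swap a i) _ hea using 1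
  funext j
  by_cases hj : i = j
  · subst hj; simp
  · have : Equiv.swap a i j ≠ a := by
      intro h
      apply hj
      rw [Equiv.swap_apply_eq_iff, Equiv.swap_apply_left] at h
      exact h.symm
    simp [hj, this]
end

section
/- Let p be a prime, L a finitely generated free ℤ_p-module, and W a finite group acting on L by ℤ_p-linear automorphisms such that the induced F_p[W]-module L ⊗ F_p is simple and the W-action on L ⊗ F_p is nontrivial. Then: (a) the coinvariants of L vanish, i.e., L is generated as a ℤ_p-module by the elements w·x − x with w ∈ W and x ∈ L; and (b) the W-fixed points of L ⊗_{ℤ_p} (ℚ_p/ℤ_p) are zero. -/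
open scoped TensorProduct

/-- Every element of `L ⊗ ℚ_p/ℤ_p` is of the form `x ⊗ p^{-n}`. -/
theorem aux_exists_rep (p : ℕ) [Fact p.Prime]
    (L : Type*) [AddCommGroup L] [Module ℤ_[p] L]
    (t : L ⊗[ℤ_[p]] (ℚ_[p] ⧸ Submodule.span ℤ_[p] ({1} : Set ℚ_[p]))) :
    ∃ (n : ℕ) (x : L), t = x ⊗ₜ (Submodule.Quotient.mk (((p : ℚ_[p]) ^ n)⁻¹)) := by
  have hp0 : (p : ℚ_[p]) ≠ 0 := by exact_mod_cast (Fact.out : p.Prime).ne_zero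
  have key : ∀ (n m : ℕ) (x : L),
      x ⊗ₜ[ℤ_[p]] (Submodule.Quotient.mk (((p : ℚ_[p]) ^ n)⁻¹) :
        ℚ_[p] ⧸ Submodule.span ℤ_[p] ({1} : Set ℚ_[p])) =
      (((p : ℤ_[p]) ^ m) • x) ⊗ₜ (Submodule.Quotient.mk (((p : ℚ_[p]) ^ (n + m))⁻¹)) := by
    intro n m x
    rw [TensorProduct.smul_tmul, ← Submodule.Quotient.mk_smul]
    congr 2
    rw [Algebra.smul_def]
    simp only [map_pow, map_natCast]
    field_simp
    rw [pow_add]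
  induction t using TensorProduct.induction_on with
  | zero => exact ⟨0, 0, by simp⟩
  | tmul x q =>
    obtain ⟨q, rfl⟩ := Submodule.Quotient.mk_surjective _ q
    obtain ⟨n, hn⟩ : ∃ n : ℕ, ‖q‖ < (p : ℝ) ^ n :=
      pow_unbounded_of_one_lt _ (by exact_mod_cast (Fact.out : p.Prime).one_lt)
    have hpos : (0 : ℝ) < (p : ℝ) ^ n := pow_pos (by exact_mod_cast (Fact.out : p.Prime).pos) n
    have h : ‖q * (p : ℚ_[p]) ^ n‖ ≤ 1 := by
      rw [norm_mul, norm_pow, Padic.norm_p, inv_pow, ← div_eq_mul_inv, div_le_one hpos]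
      exact hn.le
    let a : ℤ_[p] := ⟨_, h⟩
    refine ⟨n, a • x, ?_⟩
    rw [TensorProduct.smul_tmul, ← Submodule.Quotient.mk_smul]
    congr 2
    rw [Algebra.smul_def]
    change q = (q * (p : ℚ_[p]) ^ n) * _
    field_simp
  | add a b ha hb =>
    obtain ⟨n, x, rfl⟩ := ha
    obtain ⟨m, y, rfl⟩ := hb
    refine ⟨n + m, ((p : ℤ_[p]) ^ m) • x + ((p : ℤ_[p]) ^ n) • y, ?_⟩
    rw [TensorProduct.add_tmul, ← key n m x, add_comm n m, ← key m n y]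

theorem aux_tmul_eq_zero (p : ℕ) [Fact p.Prime]
    (L : Type*) [AddCommGroup L] [Module ℤ_[p] L]
    [Module.Free ℤ_[p] L] [Module.Finite ℤ_[p] L] (n : ℕ) (x : L)
    (h : x ⊗ₜ[ℤ_[p]] (Submodule.Quotient.mk (((p : ℚ_[p]) ^ (n + 1))⁻¹) :
        ℚ_[p] ⧸ Submodule.span ℤ_[p] ({1} : Set ℚ_[p])) = 0) :
    ∃ y : L, x = (p : ℤ_[p]) • y := by
  have hp0 : (p : ℚ_[p]) ≠ 0 := by exact_mod_cast (Fact.out : p.Prime).ne_zero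
  let b := Module.Free.chooseBasis ℤ_[p] L
  have hc : ∀ i, ∃ c : ℤ_[p], b.repr x i = (p : ℤ_[p]) * c := by
    intro i
    have h1 := congrArg (fun t => TensorProduct.lid _ _ (LinearMap.rTensor _ (b.coord i) t)) h
    simp only [LinearMap.rTensor_tmul, TensorProduct.lid_tmul, map_zero,
      ← Submodule.Quotient.mk_smul, Submodule.Quotient.mk_eq_zero,
      Submodule.mem_span_singleton, Module.Basis.coord_apply] at h1
    obtain ⟨a, ha⟩ := h1
    refine ⟨(p : ℤ_[p]) ^ n * a, ?_⟩
    rw [Algebra.smul_def, Algebra.smul_def] at ha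
    change (a : ℚ_[p]) * 1 = (b.repr x i : ℤ_[p]) * _ at ha
    apply PadicInt.ext
    push_cast
    field_simp at ha
    rw [← ha]
    ring
  choose c hc using hc
  refine ⟨∑ i, c i • b i, ?_⟩
  conv_lhs => rw [← b.sum_repr x]
  rw [Finset.smul_sum]
  refine Finset.sum_congr rfl fun i _ => ?_
  rw [hc i, mul_smul]

/-- Let `p` be a prime, `L` a finitely generated free `ℤ_p`-module, and `W`
a finite group acting on `L` by `ℤ_p`-linear automorphisms such that the induced `F_p[W]`-module
`L ⊗ F_p = L/pL` is simple and the `W`-action on `L ⊗ F_p` is nontrivial.  Then: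
(a) the coinvariants of `L` vanish, i.e. `L` is generated as a `ℤ_p`-module by the elements
`w·x − x` with `w ∈ W` and `x ∈ L`; and (b) the `W`-fixed points of `L ⊗_{ℤ_p} (ℚ_p/ℤ_p)` are
zero. -/
theorem coinvariants_eq_top_and_divisible_fixed_points_eq_zero
    (p : ℕ) [Fact p.Prime]
    (L : Type*) [AddCommGroup L] [Module ℤ_[p] L]
    [Module.Free ℤ_[p] L] [Module.Finite ℤ_[p] L]
    (W : Type*) [Group W] [Finite W]
    (ρ : W →* (L ≃ₗ[ℤ_[p]] L)) :
    -- `P = pL`, so that `L ⊗ F_p = L ⧸ P`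
    letI P : Submodule ℤ_[p] L :=
      LinearMap.range ((p : ℤ_[p]) • (LinearMap.id : L →ₗ[ℤ_[p]] L))
    -- `ℚ_p/ℤ_p` as a `ℤ_p`-module
    letI Q : Type _ := ℚ_[p] ⧸ Submodule.span ℤ_[p] ({1} : Set ℚ_[p])
    -- `L ⊗ F_p` is a simple `F_p[W]`-module …
    ∀ (_hsimple : ∀ N : Submodule ℤ_[p] L, P ≤ N →
        (∀ (w : W), ∀ x ∈ N, ρ w x ∈ N) → N = P ∨ N = ⊤)
      (_hne : P ≠ ⊤)
      -- … and the `W`-action on `L ⊗ F_p` is nontrivial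
      (_hnontriv : ∃ (w : W) (x : L), ρ w x - x ∉ P),
      -- (a) the coinvariants of `L` vanish
      (Submodule.span ℤ_[p] {y : L | ∃ (w : W) (x : L), y = ρ w x - x} = ⊤) ∧
      -- (b) the `W`-fixed points of `L ⊗ (ℚ_p/ℤ_p)` vanish
      (∀ t : L ⊗[ℤ_[p]] Q,
        (∀ w : W, LinearMap.rTensor Q ((ρ w : L ≃ₗ[ℤ_[p]] L) : L →ₗ[ℤ_[p]] L) t = t) →
        t = 0) := by
  intro hs hne hnt
  set P : Submodule ℤ_[p] L :=
    LinearMap.range ((p : ℤ_[p]) • (LinearMap.id : L →ₗ[ℤ_[p]] L)) with hP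
  have memP : ∀ y : L, y ∈ P ↔ ∃ z : L, (p : ℤ_[p]) • z = y := fun y => by
    simp [P, LinearMap.mem_range]
  have Pstab : ∀ (w : W), ∀ x ∈ P, ρ w x ∈ P := by
    intro w x hx
    obtain ⟨z, rfl⟩ := (memP x).1 hx
    exact (memP _).2 ⟨ρ w z, by simp⟩
  constructor
  · set I := Submodule.span ℤ_[p] {y : L | ∃ (w : W) (x : L), y = ρ w x - x} with hI
    have hmem : ∀ w x, ρ w x - x ∈ I := fun w x => Submodule.subset_span ⟨w, x, rfl⟩
    have htop : I ⊔ P = ⊤ := by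
      rcases hs (I ⊔ P) le_sup_right (fun w x hx => by
        have := (I ⊔ P).add_mem (Submodule.mem_sup_left (hmem w x)) hx
        simpa using this) with h | h
      · obtain ⟨w, x, hwx⟩ := hnt
        exact absurd (h ▸ Submodule.mem_sup_left (hmem w x) : ρ w x - x ∈ P) hwx
      · exact h
    have hle : (⊤ : Submodule ℤ_[p] L) ≤ I := by
      refine Submodule.le_of_le_smul_of_le_jacobson_bot (I := IsLocalRing.maximalIdeal ℤ_[p])
        Module.Finite.fg_top (IsLocalRing.maximalIdeal_le_jacobson _) ?_
      rw [← htop]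
      refine sup_le_sup_left ?_ _
      intro y hy
      obtain ⟨z, rfl⟩ := (memP y).1 hy
      refine Submodule.smul_mem_smul ?_ (htop ▸ Submodule.mem_top)
      rw [PadicInt.maximalIdeal_eq_span_p]
      exact Ideal.mem_span_singleton_self _
    exact top_le_iff.1 hle
  · let N : Submodule ℤ_[p] L :=
      { carrier := {x | ∀ w : W, ρ w x - x ∈ P}
        zero_mem' := by intro w; simp
        add_mem' := by
          intro a b ha hb w
          have := P.add_mem (ha w) (hb w)
          rw [map_add]
          convert this using 1
          abel
        smul_mem' := by
          intro c a ha w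
          have := P.smul_mem c (ha w)
          rw [map_smul, ← smul_sub]
          exact this }
    have hN : N = P := by
      rcases hs N (fun x hx w => P.sub_mem (Pstab w x hx) hx) (fun w x hx v => by
        have := P.sub_mem (hx (v * w)) (hx w)
        rw [map_mul] at this
        simpa using this) with h | h
      · exact h
      · obtain ⟨w, x, hwx⟩ := hnt
        exact absurd ((h ▸ Submodule.mem_top : x ∈ N) w) hwx
    intro t ht
    obtain ⟨n, x, rfl⟩ := aux_exists_rep p L t
    induction n generalizing x with
    | zero =>
      have : (Submodule.Quotient.mk (((p : ℚ_[p]) ^ 0)⁻¹) : ℚ_[p] ⧸ Submodule.span ℤ_[p] ({1} : Set ℚ_[p])) = 0 := by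
        rw [Submodule.Quotient.mk_eq_zero]
        simpa using Submodule.mem_span_singleton_self (1 : ℚ_[p])
      exact (congrArg (fun q : ℚ_[p] ⧸ Submodule.span ℤ_[p] ({1} : Set ℚ_[p]) => x ⊗ₜ[ℤ_[p]] q) this).trans (TensorProduct.tmul_zero _ _)
    | succ n ih =>
      have hx : x ∈ N := by
        intro w
        have h := ht w
        rw [LinearMap.rTensor_tmul] at h
        obtain ⟨y, hy⟩ := aux_tmul_eq_zero p L n (ρ w x - x) (by
          rw [TensorProduct.sub_tmul]; exact sub_eq_zero.2 h)
        exact (memP _).2 ⟨y, hy.symm⟩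
      rw [hN] at hx
      obtain ⟨y, rfl⟩ := (memP x).1 hx
      have hp0 : (p : ℚ_[p]) ≠ 0 := by exact_mod_cast (Fact.out : p.Prime).ne_zero
      have e : ((p : ℤ_[p]) • y) ⊗ₜ[ℤ_[p]] (Submodule.Quotient.mk (((p : ℚ_[p]) ^ (n + 1))⁻¹) : ℚ_[p] ⧸ Submodule.span ℤ_[p] ({1} : Set ℚ_[p]))
          = y ⊗ₜ[ℤ_[p]] (Submodule.Quotient.mk (((p : ℚ_[p]) ^ n)⁻¹) : ℚ_[p] ⧸ Submodule.span ℤ_[p] ({1} : Set ℚ_[p])) := by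
        rw [TensorProduct.smul_tmul, ← Submodule.Quotient.mk_smul]
        congr 2
        rw [Algebra.smul_def]
        simp only [map_natCast]
        field_simp
        ring
      rw [e] at ht ⊢
      exact ih y ht
end

section
/- Let p be a prime, let m ≥ 2 and n ≥ 2 be integers with m dividing p − 1, let r be a divisor of m, and fix an element ζ ∈ ℤ_p^× of multiplicative order m. Let N be the subgroup of GL_n(ℤ_p) generated by G(m,1,n) together with all scalar matrices λ·I_n with λ ∈ ℤ_p^×. Then G(m,r,n) is a normal subgroup of N, the homomorphism A(m,1,n) × ℤ_p^× → N/G(m,r,n) sending (d, λ) to the coset of λ·d is surjective, and its kernel is the subgroup of A(m,1,n) × ℤ_p^× generated by A(m,r,n) × {1} together with the element (ζ·I_n, ζ⁻¹). -/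
open scoped MatrixGroups

/-- The monomial matrix with permutation pattern `σ` and nonzero entries `d`. -/
def monMat {R : Type*} [Semiring R] {n : ℕ} (σ : Equiv.Perm (Fin n)) (d : Fin n → R) :
    Matrix (Fin n) (Fin n) R :=
  Matrix.of fun i j => if i = σ j then d j else 0

theorem monMat_mul {R : Type*} [CommRing R] {n : ℕ} (σ₁ σ₂ : Equiv.Perm (Fin n))
    (d₁ d₂ : Fin n → R) :
    monMat σ₁ d₁ * monMat σ₂ d₂ = monMat (σ₁ * σ₂) (fun j => d₁ (σ₂ j) * d₂ j) := by
  ext i j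
  rw [Matrix.mul_apply, Finset.sum_eq_single (σ₂ j)]
  · simp only [monMat, Matrix.of_apply, Equiv.Perm.mul_apply, if_pos rfl]
    by_cases h : i = σ₁ (σ₂ j) <;> simp [h]
  · intro k _ hk
    simp [monMat, hk]
  · intro h
    exact absurd (Finset.mem_univ _) h

theorem monMat_one {R : Type*} [Semiring R] {n : ℕ} :
    (monMat (1 : Equiv.Perm (Fin n)) (fun _ => (1 : R))) = 1 := by
  ext i j
  rw [Matrix.one_apply]
  rfl

/-- The group `G(m,s,n)` realized over `ℤ_p` (for `m ∣ p − 1`): the subgroup of `GL_n(ℤ_p)`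
consisting of all monomial matrices whose nonzero entries are `m`-th roots of unity and the
product of whose nonzero entries is an `(m/s)`-th root of unity. -/
def Gmsn (p : ℕ) [Fact p.Prime] (m : ℕ) (hm : 0 < m) (n s : ℕ) :
    Subgroup (GL (Fin n) ℤ_[p]) where
  carrier := {g : GL (Fin n) ℤ_[p] | ∃ (σ : Equiv.Perm (Fin n)) (d : Fin n → ℤ_[p]),
    (∀ j, d j ^ m = 1) ∧ ((∏ j, d j) ^ (m / s) = 1) ∧
    (g : Matrix (Fin n) (Fin n) ℤ_[p]) = monMat σ d}
  one_mem' := ⟨1, fun _ => 1, fun _ => one_pow m,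
    by rw [Finset.prod_const_one, one_pow],
    by rw [Units.val_one, monMat_one]⟩
  mul_mem' := by
    rintro a b ⟨σ₁, d₁, h₁, h₁', e₁⟩ ⟨σ₂, d₂, h₂, h₂', e₂⟩
    refine ⟨σ₁ * σ₂, fun j => d₁ (σ₂ j) * d₂ j, fun j => ?_, ?_, ?_⟩
    · rw [mul_pow, h₁, h₂, one_mul]
    · rw [Finset.prod_mul_distrib, Equiv.prod_comp σ₂ d₁, mul_pow, h₁', h₂', one_mul]
    · rw [Units.val_mul, e₁, e₂, monMat_mul]
  inv_mem' := by
    rintro a ⟨σ, d, h, h', e⟩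
    refine ⟨σ⁻¹, fun j => d (σ⁻¹ j) ^ (m - 1), fun j => ?_, ?_, ?_⟩
    · rw [← pow_mul, mul_comm, pow_mul, h, one_pow]
    · calc (∏ j, d (σ⁻¹ j) ^ (m - 1)) ^ (m / s)
          = ((∏ j, d j) ^ (m - 1)) ^ (m / s) := by
            rw [Equiv.prod_comp σ⁻¹ (fun j => d j ^ (m - 1)), Finset.prod_pow]
        _ = ((∏ j, d j) ^ (m / s)) ^ (m - 1) := by rw [← pow_mul, mul_comm, pow_mul]
        _ = 1 := by rw [h', one_pow]
    · have key : (a : Matrix (Fin n) (Fin n) ℤ_[p]) *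
          monMat σ⁻¹ (fun j => d (σ⁻¹ j) ^ (m - 1)) = 1 := by
        rw [e, monMat_mul, mul_inv_cancel]
        have hd : (fun j => d (σ⁻¹ j) * d (σ⁻¹ j) ^ (m - 1)) = fun _ => (1 : ℤ_[p]) := by
          funext j
          rw [mul_comm, ← pow_succ, Nat.sub_add_cancel hm, h]
        rw [hd, monMat_one]
      exact Units.inv_eq_of_mul_eq_one_right key

/-- The subgroup `A(m,s,n)` of diagonal matrices in `G(m,s,n)`. -/
def Amn (p : ℕ) [Fact p.Prime] (m : ℕ) (hm : 0 < m) (n s : ℕ) :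
    Subgroup (GL (Fin n) ℤ_[p]) where
  carrier := {g : GL (Fin n) ℤ_[p] | ∃ d : Fin n → ℤ_[p],
    (∀ j, d j ^ m = 1) ∧ ((∏ j, d j) ^ (m / s) = 1) ∧
    (g : Matrix (Fin n) (Fin n) ℤ_[p]) = monMat 1 d}
  one_mem' := ⟨fun _ => 1, fun _ => one_pow m,
    by rw [Finset.prod_const_one, one_pow],
    by rw [Units.val_one, monMat_one]⟩
  mul_mem' := by
    rintro a b ⟨d₁, h₁, h₁', e₁⟩ ⟨d₂, h₂, h₂', e₂⟩
    refine ⟨fun j => d₁ j * d₂ j, fun j => ?_, ?_, ?_⟩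
    · rw [mul_pow, h₁, h₂, one_mul]
    · rw [Finset.prod_mul_distrib, mul_pow, h₁', h₂', one_mul]
    · rw [Units.val_mul, e₁, e₂, monMat_mul, one_mul]
      rfl
  inv_mem' := by
    rintro a ⟨d, h, h', e⟩
    refine ⟨fun j => d j ^ (m - 1), fun j => ?_, ?_, ?_⟩
    · rw [← pow_mul, mul_comm, pow_mul, h, one_pow]
    · rw [Finset.prod_pow, ← pow_mul, mul_comm, pow_mul, h', one_pow]
    · have key : (a : Matrix (Fin n) (Fin n) ℤ_[p]) *
          monMat 1 (fun j => d j ^ (m - 1)) = 1 := by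
        rw [e, monMat_mul, one_mul]
        have hd : (fun j => d ((1 : Equiv.Perm (Fin n)) j) * d j ^ (m - 1)) =
            fun _ => (1 : ℤ_[p]) := by
          funext j
          show d j * d j ^ (m - 1) = 1
          rw [mul_comm, ← pow_succ, Nat.sub_add_cancel hm, h]
        rw [hd, monMat_one]
      exact Units.inv_eq_of_mul_eq_one_right key

/-- The homomorphism sending a unit `λ ∈ ℤ_p^×` to the scalar matrix `λ·Iₙ ∈ GL_n(ℤ_p)`. -/
noncomputable def scalarGL (p : ℕ) [Fact p.Prime] (n : ℕ) : ℤ_[p]ˣ →* GL (Fin n) ℤ_[p] :=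
  Units.map (algebraMap ℤ_[p] (Matrix (Fin n) (Fin n) ℤ_[p])).toMonoidHom

theorem scalarGL_mem_Amn (p : ℕ) [Fact p.Prime] (m : ℕ) (hm : 0 < m) (n : ℕ)
    (ζ : ℤ_[p]ˣ) (hζ : (ζ : ℤ_[p]) ^ m = 1) :
    scalarGL p n ζ ∈ Amn p m hm n 1 := by
  refine ⟨fun _ => (ζ : ℤ_[p]), fun _ => hζ, ?_, ?_⟩
  · rw [Finset.prod_const, Nat.div_one, Finset.card_univ, Fintype.card_fin, ← pow_mul,
      mul_comm, pow_mul, hζ, one_pow]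
  · refine Matrix.ext fun i j => ?_
    change algebraMap ℤ_[p] (Matrix (Fin n) (Fin n) ℤ_[p]) (ζ : ℤ_[p]) i j = _
    rw [Matrix.algebraMap_matrix_apply]
    rfl

theorem monMat_inj {R : Type*} [Semiring R] {n : ℕ} {σ τ : Equiv.Perm (Fin n)}
    {d e : Fin n → R} (hd : ∀ j, d j ≠ 0) (h : monMat σ d = monMat τ e) : σ = τ ∧ d = e := by
  have h1 : ∀ j, σ j = τ j ∧ d j = e j := by
    intro j
    have := congrFun (congrFun h (σ j)) j
    simp only [monMat, Matrix.of_apply, if_true] at this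
    by_cases hc : σ j = τ j
    · rw [if_pos hc] at this
      exact ⟨hc, this⟩
    · rw [if_neg hc] at this
      exact absurd this (hd j)
  exact ⟨Equiv.ext fun j => (h1 j).1, funext fun j => (h1 j).2⟩

theorem ne_zero_of_pow_one {R : Type*} [Semiring R] [Nontrivial R] {m : ℕ} (hm : 0 < m) {a : R}
    (h : a ^ m = 1) : a ≠ 0 := by
  rintro rfl
  rw [zero_pow hm.ne'] at h
  exact zero_ne_one h

theorem scalarGL_val (p : ℕ) [Fact p.Prime] (n : ℕ) (l : ℤ_[p]ˣ) :
    (scalarGL p n l : Matrix (Fin n) (Fin n) ℤ_[p]) = monMat 1 (fun _ => (l : ℤ_[p])) := by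
  refine Matrix.ext fun i j => ?_
  change algebraMap ℤ_[p] (Matrix (Fin n) (Fin n) ℤ_[p]) (l : ℤ_[p]) i j = _
  rw [Matrix.algebraMap_matrix_apply]
  rfl

theorem scalarGL_comm (p : ℕ) [Fact p.Prime] (n : ℕ) (l : ℤ_[p]ˣ) (g : GL (Fin n) ℤ_[p]) :
    scalarGL p n l * g = g * scalarGL p n l :=
  Units.ext (Algebra.commutes (l : ℤ_[p]) (g : Matrix (Fin n) (Fin n) ℤ_[p]))

theorem Gmsn_le_one (p : ℕ) [Fact p.Prime] (m : ℕ) (hm : 0 < m) (n s : ℕ) :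
    Gmsn p m hm n s ≤ Gmsn p m hm n 1 := by
  rintro g ⟨σ, d, h, -, e⟩
  refine ⟨σ, d, h, ?_, e⟩
  rw [Nat.div_one, ← Finset.prod_pow]
  exact Finset.prod_eq_one fun j _ => h j

theorem Gmsn_conj (p : ℕ) [Fact p.Prime] (m : ℕ) (hm : 0 < m) (n s : ℕ)
    (g h : GL (Fin n) ℤ_[p]) (hg : g ∈ Gmsn p m hm n 1) (hh : h ∈ Gmsn p m hm n s) :
    g * h * g⁻¹ ∈ Gmsn p m hm n s := by
  obtain ⟨τ, c, hc, -, ec⟩ := (Gmsn p m hm n 1).inv_mem hg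
  obtain ⟨σ, d, hd, -, ed⟩ := hg
  obtain ⟨ρ, b, hb, hb', eb⟩ := hh
  have key : monMat (τ * σ) (fun j => c (σ j) * d j) = monMat 1 (fun _ => (1 : ℤ_[p])) := by
    rw [← monMat_mul, ← ec, ← ed, ← Units.val_mul, inv_mul_cancel, monMat_one, Units.val_one]
  have hcd := (monMat_inj (fun j => mul_ne_zero (ne_zero_of_pow_one hm (hc _))
    (ne_zero_of_pow_one hm (hd _))) key).2
  have hprod : (∏ j, c j) * ∏ j, d j = 1 := by
    rw [← Equiv.prod_comp σ c, ← Finset.prod_mul_distrib]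
    exact Finset.prod_eq_one fun j _ => congrFun hcd j
  refine ⟨σ * ρ * τ, fun j => d (ρ (τ j)) * b (τ j) * c j, fun j => ?_, ?_, ?_⟩
  · rw [mul_pow, mul_pow, hd, hb, hc, one_mul, one_mul]
  · rw [Finset.prod_mul_distrib, Finset.prod_mul_distrib, Equiv.prod_comp τ b,
      Equiv.prod_comp τ (fun j => d (ρ j)), Equiv.prod_comp ρ d]
    have : (∏ j, d j) * (∏ j, b j) * ∏ j, c j = ∏ j, b j := by
      linear_combination (∏ j, b j) * hprod
    rw [this, hb']
  · rw [Units.val_mul, Units.val_mul, ed, eb, ec, monMat_mul, monMat_mul]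

theorem N_decomp (p : ℕ) [Fact p.Prime] (m : ℕ) (hm : 0 < m) (n : ℕ) (x : GL (Fin n) ℤ_[p])
    (hx : x ∈ Subgroup.closure
        ((Gmsn p m hm n 1 : Set (GL (Fin n) ℤ_[p])) ∪ Set.range (scalarGL p n))) :
    ∃ l : ℤ_[p]ˣ, ∃ g ∈ Gmsn p m hm n 1, x = scalarGL p n l * g := by
  induction hx using Subgroup.closure_induction with
  | mem x hx =>
    rcases hx with hx | ⟨l, rfl⟩
    · exact ⟨1, x, hx, by simp⟩
    · exact ⟨l, 1, Subgroup.one_mem _, by simp⟩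
  | one => exact ⟨1, 1, Subgroup.one_mem _, by simp⟩
  | mul x y _ _ hx hy =>
    obtain ⟨l, g, hg, rfl⟩ := hx
    obtain ⟨k, h, hh, rfl⟩ := hy
    refine ⟨l * k, g * h, Subgroup.mul_mem _ hg hh, ?_⟩
    rw [map_mul, mul_assoc, ← mul_assoc g, ← scalarGL_comm, mul_assoc, mul_assoc]
  | inv x _ hx =>
    obtain ⟨l, g, hg, rfl⟩ := hx
    exact ⟨l⁻¹, g⁻¹, Subgroup.inv_mem _ hg, by rw [mul_inv_rev, map_inv, ← map_inv, scalarGL_comm]⟩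

/-- Split a monomial matrix as diagonal times permutation. -/
theorem G_split (p : ℕ) [Fact p.Prime] (m : ℕ) (hm : 0 < m) (n s : ℕ) (g : GL (Fin n) ℤ_[p])
    (hg : g ∈ Gmsn p m hm n 1) :
    ∃ d ∈ Amn p m hm n 1, d⁻¹ * g ∈ Gmsn p m hm n s := by
  obtain ⟨σ, d, hd, hd', ed⟩ := hg
  let P : GL (Fin n) ℤ_[p] :=
    ⟨monMat σ (fun _ => 1), monMat σ⁻¹ (fun _ => 1),
      by rw [monMat_mul]; simp [monMat_one], by rw [monMat_mul]; simp [monMat_one]⟩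
  have hP : P ∈ Gmsn p m hm n s := ⟨σ, fun _ => 1, fun _ => one_pow _, by simp, rfl⟩
  refine ⟨g * P⁻¹, ⟨fun j => d (σ⁻¹ j), fun j => hd _, ?_, ?_⟩, ?_⟩
  · rw [Equiv.prod_comp σ⁻¹ d, hd']
  · rw [Units.val_mul, ed]
    change monMat σ d * monMat σ⁻¹ (fun _ => 1) = _
    rw [monMat_mul, mul_inv_cancel]
    simp
  · simpa using hP

theorem A_of_G (p : ℕ) [Fact p.Prime] (m : ℕ) (hm : 0 < m) (n s : ℕ) (g : GL (Fin n) ℤ_[p])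
    (hg : g ∈ Gmsn p m hm n s) (d : Fin n → ℤ_[p])
    (e : (g : Matrix (Fin n) (Fin n) ℤ_[p]) = monMat 1 d) :
    g ∈ Amn p m hm n s ∧ ∀ j, d j ^ m = 1 := by
  obtain ⟨σ, c, hc, hc', ec⟩ := hg
  obtain ⟨rfl, rfl⟩ := monMat_inj (fun j => ne_zero_of_pow_one hm (hc j)) (ec.symm.trans e)
  exact ⟨⟨c, hc, hc', e⟩, hc⟩

theorem Amn_le_Gmsn (p : ℕ) [Fact p.Prime] (m : ℕ) (hm : 0 < m) (n s : ℕ) :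
    Amn p m hm n s ≤ Gmsn p m hm n s := by
  rintro g ⟨d, h, h', e⟩
  exact ⟨1, d, h, h', e⟩

/-- Let `p` be a prime, `m, n ≥ 2` integers with `m ∣ p − 1`, `r` a divisor
of `m`, and `ζ ∈ ℤ_p^×` an element of multiplicative order `m`.  Let `N ≤ GL_n(ℤ_p)` be the
subgroup generated by `G(m,1,n)` together with all scalar matrices `λ·Iₙ`, `λ ∈ ℤ_p^×`.  Then
`G(m,r,n)` is a normal subgroup of `N`, the homomorphism
`A(m,1,n) × ℤ_p^× → N/G(m,r,n)`, `(d, λ) ↦ [λ·d]`, is surjective, and its kernel is the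
subgroup of `A(m,1,n) × ℤ_p^×` generated by `A(m,r,n) × {1}` together with the element
`(ζ·Iₙ, ζ⁻¹)`. -/
theorem Gmrn_normal_in_N_and_quotient_description
    (p m n r : ℕ) [Fact p.Prime] (hm : 2 ≤ m) (hn : 2 ≤ n)
    (hdvd : m ∣ p - 1) (hr : r ∣ m)
    (ζ : ℤ_[p]ˣ) (hζ : orderOf ζ = m) :
    letI hm0 : 0 < m := by omega
    letI N : Subgroup (GL (Fin n) ℤ_[p]) :=
      Subgroup.closure
        ((Gmsn p m hm0 n 1 : Set (GL (Fin n) ℤ_[p])) ∪ Set.range (scalarGL p n))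
    -- `G(m,r,n)` is a normal subgroup of `N`
    (Gmsn p m hm0 n r ≤ N) ∧
    ((Gmsn p m hm0 n r).subgroupOf N).Normal ∧
    -- the map `(d, λ) ↦ [λ·d]` to `N/G(m,r,n)` is surjective …
    (∀ x ∈ N, ∃ (d : Amn p m hm0 n 1) (lam : ℤ_[p]ˣ),
      (scalarGL p n lam * (d : GL (Fin n) ℤ_[p]))⁻¹ * x ∈ Gmsn p m hm0 n r) ∧
    -- … and its kernel is generated by `A(m,r,n) × {1}` and `(ζ·Iₙ, ζ⁻¹)`
    ({y : (Amn p m hm0 n 1) × ℤ_[p]ˣ |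
        scalarGL p n y.2 * (y.1 : GL (Fin n) ℤ_[p]) ∈ Gmsn p m hm0 n r} =
      (Subgroup.closure
        ({y : (Amn p m hm0 n 1) × ℤ_[p]ˣ |
            (y.1 : GL (Fin n) ℤ_[p]) ∈ Amn p m hm0 n r ∧ y.2 = 1} ∪
          {(⟨scalarGL p n ζ,
              scalarGL_mem_Amn p m (by omega) n ζ
                (by rw [← Units.val_pow_eq_pow_val, ← hζ, pow_orderOf_eq_one, Units.val_one])⟩,
            ζ⁻¹)}) :
        Set ((Amn p m hm0 n 1) × ℤ_[p]ˣ))) := by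
  have hm0 : 0 < m := by omega
  refine ⟨?_, ?_, ?_, ?_⟩
  · exact (Gmsn_le_one p m hm0 n r).trans
      (fun g hg => Subgroup.subset_closure (Or.inl hg))
  · constructor
    rintro ⟨h, hhN⟩ hh ⟨x, hx⟩
    obtain ⟨l, g, hg, rfl⟩ := N_decomp p m hm0 n x hx
    rw [Subgroup.mem_subgroupOf] at hh ⊢
    have h1 := Gmsn_conj p m hm0 n r g h hg hh
    change scalarGL p n l * g * h * (scalarGL p n l * g)⁻¹ ∈ _
    have : scalarGL p n l * g * h * (scalarGL p n l * g)⁻¹ = g * h * g⁻¹ := by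
      rw [mul_assoc (scalarGL p n l), scalarGL_comm, scalarGL_comm p n l g]
      group
    rw [this]
    exact h1
  · intro x hx
    obtain ⟨l, g, hg, rfl⟩ := N_decomp p m hm0 n x hx
    obtain ⟨d, hd, hdg⟩ := G_split p m hm0 n r g hg
    refine ⟨⟨d, hd⟩, l, ?_⟩
    have : (scalarGL p n l * d)⁻¹ * (scalarGL p n l * g) = d⁻¹ * g := by group
    change (scalarGL p n l * d)⁻¹ * (scalarGL p n l * g) ∈ _
    rw [this]
    exact hdg
  · have hζm : ζ ^ m = 1 := by rw [← hζ, pow_orderOf_eq_one]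
    have hprim : IsPrimitiveRoot ζ m := hζ ▸ IsPrimitiveRoot.orderOf ζ
    set S : Set ((Amn p m hm0 n 1) × ℤ_[p]ˣ) := {y | (y.1 : GL (Fin n) ℤ_[p]) ∈ Amn p m hm0 n r ∧ y.2 = 1} with hS
    generalize_proofs pf
    set z : (Amn p m hm0 n 1) × ℤ_[p]ˣ := (⟨scalarGL p n ζ, pf⟩, ζ⁻¹) with hz
    apply Set.Subset.antisymm
    · rintro ⟨⟨d, hd⟩, l⟩ hy
      change scalarGL p n l * d ∈ Gmsn p m hm0 n r at hy
      obtain ⟨c, hc, hc', ec⟩ := id hd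
      have hA := A_of_G p m hm0 n r _ hy (fun j => l * c j)
        (by rw [Units.val_mul, scalarGL_val, ec, monMat_mul, one_mul])
      have hl : l ^ m = 1 := by
        have h0 := hA.2 ⟨0, by omega⟩
        rw [mul_pow, hc, mul_one] at h0
        exact Units.ext (by simpa using h0)
      have : NeZero m := ⟨hm0.ne'⟩
      obtain ⟨k, -, hk'⟩ := (IsPrimitiveRoot.coe_units_iff.2 hprim.inv).eq_pow_of_pow_eq_one
        (ξ := (l : ℤ_[p])) (by rw [← Units.val_pow_eq_pow_val, hl, Units.val_one])
      have hk : (ζ⁻¹) ^ k = l := Units.ext (by rw [Units.val_pow_eq_pow_val, hk'])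
      have hw : scalarGL p n l * d ∈ Amn p m hm0 n 1 :=
        Subgroup.mul_mem _ (scalarGL_mem_Amn p m hm0 n l (by
          rw [← Units.val_pow_eq_pow_val, hl, Units.val_one])) hd
      have heq : ((⟨d, hd⟩, l) : (Amn p m hm0 n 1) × ℤ_[p]ˣ) =
          (⟨scalarGL p n l * d, hw⟩, 1) * z ^ k := by
        refine Prod.ext (Subtype.ext ?_) ?_
        · change d = scalarGL p n l * d * (scalarGL p n ζ) ^ k
          rw [scalarGL_comm, mul_assoc, ← map_pow, ← map_mul, ← hk, inv_pow, inv_mul_cancel,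
            map_one, mul_one]
        · change l = 1 * (ζ⁻¹) ^ k
          rw [one_mul, hk]
      rw [heq]
      have i1 : ((⟨scalarGL p n l * d, hw⟩, 1) : (Amn p m hm0 n 1) × ℤ_[p]ˣ) ∈
          Subgroup.closure (S ∪ {z}) := Subgroup.subset_closure (Or.inl ⟨hA.1, rfl⟩)
      have i2 : z ∈ Subgroup.closure (S ∪ {z}) := Subgroup.subset_closure (Or.inr rfl)
      exact Subgroup.mul_mem _ i1 (Subgroup.pow_mem _ i2 k)
    · intro y hy
      induction hy using Subgroup.closure_induction with
      | mem y hy =>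
        rcases hy with ⟨h1, h2⟩ | hy
        · change scalarGL p n y.2 * (y.1 : GL (Fin n) ℤ_[p]) ∈ Gmsn p m hm0 n r
          rw [h2, map_one, one_mul]
          exact Amn_le_Gmsn p m hm0 n r h1
        · rw [Set.mem_singleton_iff] at hy
          subst hy
          change scalarGL p n ζ⁻¹ * scalarGL p n ζ ∈ Gmsn p m hm0 n r
          rw [← map_mul, inv_mul_cancel, map_one]
          exact Subgroup.one_mem _
      | one =>
        change scalarGL p n 1 * 1 ∈ Gmsn p m hm0 n r
        rw [map_one, one_mul]
        exact Subgroup.one_mem _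
      | mul x y _ _ hx hy =>
        change scalarGL p n (x.2 * y.2) * ((x.1 : GL (Fin n) ℤ_[p]) * y.1) ∈ Gmsn p m hm0 n r
        have h := Subgroup.mul_mem (Gmsn p m hm0 n r) hx hy
        convert h using 1
        rw [map_mul, mul_assoc, mul_assoc, ← mul_assoc (scalarGL p n y.2), scalarGL_comm p n y.2, mul_assoc]
      | inv x _ hx =>
        change scalarGL p n (x.2⁻¹) * (x.1 : GL (Fin n) ℤ_[p])⁻¹ ∈ Gmsn p m hm0 n r
        have h := Subgroup.inv_mem (Gmsn p m hm0 n r) hx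
        convert h using 1
        rw [mul_inv_rev, scalarGL_comm, map_inv]
end

section
/- Let p be a prime, W a finite group acting by ℤ_p-linear automorphisms on a finitely generated free ℤ_p-module L, and suppose L ⊗_{ℤ_p} ℚ_p = V₁ ⊕ V₂ where V₁ and V₂ are W-invariant ℚ_p-subspaces. Let W₂ be the subgroup of W consisting of the elements fixing V₁ pointwise, and set L₁ = L ∩ V₁ and L₂ = L ∩ V₂. If the W₂-fixed points of L₂ ⊗_{ℤ_p} (ℚ_p/ℤ_p) are zero, then the addition map L₁ ⊕ L₂ → L is an isomorphism of ℤ_p-modules. -/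
open scoped TensorProduct

theorem aux_clear (p : ℕ) [Fact p.Prime] (L : Type*) [AddCommGroup L] [Module ℤ_[p] L]
    (v : ℚ_[p] ⊗[ℤ_[p]] L) :
    ∃ a : ℤ_[p], a ≠ 0 ∧ ∃ y : L, a • v = (1 : ℚ_[p]) ⊗ₜ[ℤ_[p]] y := by
  induction v using TensorProduct.induction_on with
  | zero => exact ⟨1, one_ne_zero, 0, by simp⟩
  | tmul q x =>
    obtain ⟨b, a, ha, rfl⟩ := IsFractionRing.div_surjective (A := ℤ_[p]) q
    have ha0 : a ≠ 0 := nonZeroDivisors.ne_zero ha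
    have ha1 : algebraMap ℤ_[p] ℚ_[p] a ≠ 0 := by
      simpa using ha0
    refine ⟨a, ha0, b • x, ?_⟩
    rw [TensorProduct.smul_tmul', ← TensorProduct.smul_tmul]
    congr 1
    rw [Algebra.smul_def, Algebra.smul_def]
    field_simp
  | add u v hu hv =>
    obtain ⟨a, ha, y, hy⟩ := hu
    obtain ⟨b, hb, z, hz⟩ := hv
    refine ⟨a * b, mul_ne_zero ha hb, b • y + a • z, ?_⟩
    rw [smul_add, mul_comm a b, mul_smul, hy, mul_comm b a, mul_smul, hz, TensorProduct.tmul_add,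
      TensorProduct.tmul_smul, TensorProduct.tmul_smul]

theorem aux_div (p : ℕ) [Fact p.Prime] (M : Type*) [AddCommGroup M] [Module ℤ_[p] M]
    [Module.Free ℤ_[p] M] [Module.Finite ℤ_[p] M] (a : ℤ_[p]) (ha : a ≠ 0) (y : M)
    (h : y ⊗ₜ[ℤ_[p]] (Submodule.Quotient.mk ((algebraMap ℤ_[p] ℚ_[p] a)⁻¹) :
      ℚ_[p] ⧸ Submodule.span ℤ_[p] ({1} : Set ℚ_[p])) = 0) : ∃ z : M, y = a • z := by
  have ha1 : algebraMap ℤ_[p] ℚ_[p] a ≠ 0 := by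
    simpa using ha
  have key : ∀ f : M →ₗ[ℤ_[p]] ℤ_[p], ∃ c, f y = a * c := by
    intro f
    have h2 := congrArg (fun t => TensorProduct.lid ℤ_[p] _ (LinearMap.rTensor _ f t)) h
    simp only [LinearMap.rTensor_tmul, TensorProduct.lid_tmul, map_zero] at h2
    rw [← Submodule.Quotient.mk_smul, Submodule.Quotient.mk_eq_zero,
      Submodule.mem_span_singleton] at h2
    obtain ⟨c, hc⟩ := h2
    refine ⟨c, ?_⟩
    apply IsFractionRing.injective ℤ_[p] ℚ_[p]
    rw [Algebra.smul_def, Algebra.smul_def, mul_one] at hc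
    rw [map_mul, hc]
    field_simp
  let b := Module.Free.chooseBasis ℤ_[p] M
  choose c hc using fun i => key (b.coord i)
  refine ⟨∑ i, c i • b i, ?_⟩
  rw [Finset.smul_sum, ← b.sum_repr y]
  refine Finset.sum_congr rfl fun i _ => ?_
  rw [smul_smul, ← hc, Module.Basis.coord_apply]

/-- Let `p` be a prime, `W` a finite group acting by `ℤ_p`-linear
automorphisms on a finitely generated free `ℤ_p`-module `L`, and suppose
`L ⊗ ℚ_p = V₁ ⊕ V₂` where `V₁` and `V₂` are `W`-invariant `ℚ_p`-subspaces.  Let `W₂` be the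
subgroup of `W` consisting of the elements fixing `V₁` pointwise, and set `L₁ = L ∩ V₁` and
`L₂ = L ∩ V₂` (pulling back along `x ↦ x ⊗ 1`).  If the `W₂`-fixed points of
`L₂ ⊗_{ℤ_p} (ℚ_p/ℤ_p)` are zero, then the addition map `L₁ ⊕ L₂ → L` is an isomorphism of
`ℤ_p`-modules (equivalently, `L₁` and `L₂` are complementary submodules of `L`). -/
theorem summand_decomposition_of_fixed_points_vanish
    (p : ℕ) [Fact p.Prime]
    (L : Type*) [AddCommGroup L] [Module ℤ_[p] L]
    [Module.Free ℤ_[p] L] [Module.Finite ℤ_[p] L]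
    (W : Type*) [Group W] [Finite W]
    (ρ : W →* (L ≃ₗ[ℤ_[p]] L))
    (V₁ V₂ : Submodule ℚ_[p] (ℚ_[p] ⊗[ℤ_[p]] L))
    (hcompl : IsCompl V₁ V₂)
    (hV₁ : ∀ w : W, ∀ v ∈ V₁,
      LinearMap.baseChange ℚ_[p] ((ρ w : L ≃ₗ[ℤ_[p]] L) : L →ₗ[ℤ_[p]] L) v ∈ V₁)
    (hV₂ : ∀ w : W, ∀ v ∈ V₂,
      LinearMap.baseChange ℚ_[p] ((ρ w : L ≃ₗ[ℤ_[p]] L) : L →ₗ[ℤ_[p]] L) v ∈ V₂) :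
    -- the embedding `L → L ⊗ ℚ_p`, `x ↦ x ⊗ 1`
    letI ι : L →ₗ[ℤ_[p]] ℚ_[p] ⊗[ℤ_[p]] L := TensorProduct.mk ℤ_[p] ℚ_[p] L 1
    letI L₁ : Submodule ℤ_[p] L := Submodule.comap ι (V₁.restrictScalars ℤ_[p])
    letI L₂ : Submodule ℤ_[p] L := Submodule.comap ι (V₂.restrictScalars ℤ_[p])
    -- `ℚ_p/ℤ_p` as a `ℤ_p`-module
    letI Q : Type _ := ℚ_[p] ⧸ Submodule.span ℤ_[p] ({1} : Set ℚ_[p])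
    -- hypothesis: the `W₂`-fixed points of `L₂ ⊗ (ℚ_p/ℤ_p)` are zero
    ∀ (_hfix : ∀ t : L₂ ⊗[ℤ_[p]] Q,
        (∀ w : W,
          (∀ v ∈ V₁,
            LinearMap.baseChange ℚ_[p] ((ρ w : L ≃ₗ[ℤ_[p]] L) : L →ₗ[ℤ_[p]] L) v = v) →
          LinearMap.rTensor Q
            (((ρ w : L ≃ₗ[ℤ_[p]] L) : L →ₗ[ℤ_[p]] L).restrict
              (p := L₂) (q := L₂)
              (fun x hx => by
                have h1 : (1 : ℚ_[p]) ⊗ₜ[ℤ_[p]] x ∈ V₂ := hx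
                have h2 := hV₂ w _ h1
                rw [LinearMap.baseChange_tmul] at h2
                exact h2)) t = t) →
        t = 0),
      IsCompl L₁ L₂ := by
  intro hfix
  have inj : ∀ x : L, (1 : ℚ_[p]) ⊗ₜ[ℤ_[p]] x = 0 → x = 0 := by
    intro x hx
    have := Module.Flat.rTensor_preserves_injective_linearMap (M := L)
      (Algebra.linearMap ℤ_[p] ℚ_[p]) (IsFractionRing.injective ℤ_[p] ℚ_[p])
    have h1 : (1 : ℤ_[p]) ⊗ₜ[ℤ_[p]] x = 0 := by
      apply this
      simpa using hx
    simpa using congrArg (TensorProduct.lid ℤ_[p] L) h1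
  refine ⟨?_, ?_⟩
  · rw [Submodule.disjoint_def]
    intro x hx1 hx2
    exact inj x (Submodule.disjoint_def.1 hcompl.disjoint _ hx1 hx2)
  rw [codisjoint_iff, Submodule.eq_top_iff']
  intro x
  obtain ⟨v₁, h₁, v₂, h₂, hv⟩ := Submodule.mem_sup.1
    ((codisjoint_iff.1 hcompl.codisjoint).symm ▸ Submodule.mem_top :
      (1 : ℚ_[p]) ⊗ₜ[ℤ_[p]] x ∈ V₁ ⊔ V₂)
  obtain ⟨a, ha, y, hy⟩ := aux_clear p L v₂
  have ha1 : algebraMap ℤ_[p] ℚ_[p] a ≠ 0 := by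
    simpa using ha
  have hyV : (1 : ℚ_[p]) ⊗ₜ[ℤ_[p]] y ∈ V₂ := by
    rw [← hy]
    exact (V₂.restrictScalars ℤ_[p]).smul_mem a h₂
  have hz := fun H => aux_div p (Submodule.comap (TensorProduct.mk ℤ_[p] ℚ_[p] L 1)
    (V₂.restrictScalars ℤ_[p])) a ha ⟨y, hyV⟩ (hfix _ H)
  have cancel : ∀ u v : ℚ_[p] ⊗[ℤ_[p]] L, a • u = a • v → u = v := by
    intro u v huv
    rw [← algebraMap_smul ℚ_[p] a u, ← algebraMap_smul ℚ_[p] a v] at huv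
    exact smul_right_injective _ ha1 huv
  obtain ⟨⟨z, hzV⟩, hz⟩ := hz (by
    intro w hw
    rw [LinearMap.rTensor_tmul]
    have e1 : (1 : ℚ_[p]) ⊗ₜ[ℤ_[p]] (ρ w x - x) =
        LinearMap.baseChange ℚ_[p] ((ρ w : L ≃ₗ[ℤ_[p]] L) : L →ₗ[ℤ_[p]] L) v₂ - v₂ := by
      have := LinearMap.baseChange_tmul (A := ℚ_[p])
        (f := ((ρ w : L ≃ₗ[ℤ_[p]] L) : L →ₗ[ℤ_[p]] L)) 1 x
      rw [← hv, map_add, hw v₁ h₁] at this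
      rw [TensorProduct.tmul_sub, ← hv]
      erw [← this]
      abel
    have m : (1 : ℚ_[p]) ⊗ₜ[ℤ_[p]] (ρ w x - x) ∈ V₂ := by
      rw [e1]
      exact V₂.sub_mem (hV₂ w _ h₂) h₂
    have e2 : ρ w y - y = a • (ρ w x - x) := by
      rw [← sub_eq_zero]
      apply inj
      rw [TensorProduct.tmul_sub, TensorProduct.tmul_smul, e1, TensorProduct.tmul_sub, smul_sub,
        hy, sub_eq_zero]
      congr 1
      have := LinearMap.baseChange_tmul (A := ℚ_[p])
        (f := ((ρ w : L ≃ₗ[ℤ_[p]] L) : L →ₗ[ℤ_[p]] L)) 1 y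
      rw [← hy, LinearMap.map_smul_of_tower] at this
      exact this.symm
    rw [← sub_eq_zero, ← TensorProduct.sub_tmul]
    have e3 : ∀ q : ℚ_[p] ⧸ Submodule.span ℤ_[p] ({1} : Set ℚ_[p]), a • q = 0 →
        (a • (⟨ρ w x - x, m⟩ : Submodule.comap (TensorProduct.mk ℤ_[p] ℚ_[p] L 1)
          (V₂.restrictScalars ℤ_[p]))) ⊗ₜ[ℤ_[p]] q = 0 := by
      intro q hq
      rw [TensorProduct.smul_tmul, hq, TensorProduct.tmul_zero]
    refine Eq.trans ?_ (e3 (Submodule.Quotient.mk ((algebraMap ℤ_[p] ℚ_[p] a)⁻¹)) ?_)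
    · congr 1
      exact Subtype.ext e2
    · rw [← Submodule.Quotient.mk_smul, Submodule.Quotient.mk_eq_zero, Algebra.smul_def,
        mul_inv_cancel₀ ha1]
      exact Submodule.mem_span_singleton_self _)
  have hz' : y = a • z := congrArg Subtype.val hz
  have hzv : (1 : ℚ_[p]) ⊗ₜ[ℤ_[p]] z = v₂ := by
    apply cancel
    rw [hy, hz', TensorProduct.tmul_smul]
  refine Submodule.mem_sup.2 ⟨x - z, ?_, z, hzV, by abel⟩
  change (1 : ℚ_[p]) ⊗ₜ[ℤ_[p]] (x - z) ∈ V₁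
  rw [TensorProduct.tmul_sub, hzv, ← hv, add_sub_cancel_right]
  exact h₁
end

section
/- Let p be a prime, let m ≥ 3 and n ≥ 3 be integers with m dividing p − 1, and let r be a divisor of m. Then the column space F_p^n is a simple module for the mod p reduction of G(m,r,n): the only subspaces of F_p^n invariant under the mod p reductions of all matrices in G(m,r,n) are 0 and F_p^n. -/
open scoped BigOperators

/-- The defining condition of the complex reflection group `G(m,s,n)` realized over `ℤ_p`
(for `m ∣ p − 1`): monomial matrices whose nonzero entries are `m`-th roots of unity and the
product of whose nonzero entries is an `(m/s)`-th root of unity. -/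
def IsGmsnMatrix (p : ℕ) [Fact p.Prime] (m s n : ℕ)
    (g : Matrix (Fin n) (Fin n) ℤ_[p]) : Prop :=
  ∃ (σ : Equiv.Perm (Fin n)) (d : Fin n → ℤ_[p]),
    (∀ j, d j ^ m = 1) ∧ ((∏ j, d j) ^ (m / s) = 1) ∧
    ∀ i j, g i j = if i = σ j then d j else 0

theorem toZMod_norm_aux (p : ℕ) [Fact p.Prime] (x : ℤ_[p]) :
    ‖x‖ < 1 ↔ PadicInt.toZMod x = 0 := by
  rw [← RingHom.mem_ker, PadicInt.ker_toZMod, IsLocalRing.mem_maximalIdeal, PadicInt.mem_nonunits]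

theorem exists_zmod_root_aux (p m : ℕ) [Fact p.Prime] (hm : 3 ≤ m) (hdvd : m ∣ p - 1) :
    ∃ z : ZMod p, z ^ m = 1 ∧ z ≠ 1 := by
  obtain ⟨g, hg⟩ := IsCyclic.exists_ofOrder_eq_natCard (α := (ZMod p)ˣ)
  rw [Nat.card_eq_fintype_card, ZMod.card_units p] at hg
  obtain ⟨k, hk⟩ := hdvd
  have hp : 2 ≤ p := (Fact.out : p.Prime).two_le
  refine ⟨((g ^ k : (ZMod p)ˣ) : ZMod p), ?_, ?_⟩
  · rw [← Units.val_pow_eq_pow_val, ← pow_mul, mul_comm, ← hk, ← hg, pow_orderOf_eq_one]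
    rfl
  · intro h
    have h2 : g ^ k = 1 := Units.ext h
    have h3 := orderOf_dvd_of_pow_eq_one h2
    have hk0 : 0 < k := by
      rcases Nat.eq_zero_or_pos k with h0 | h0
      · subst h0; omega
      · exact h0
    have := Nat.le_of_dvd hk0 h3
    nlinarith

theorem exists_padic_root_aux (p m : ℕ) [Fact p.Prime] (hm : 3 ≤ m) (hdvd : m ∣ p - 1) :
    ∃ x : ℤ_[p], x ^ m = 1 ∧ PadicInt.toZMod x ≠ 1 := by
  obtain ⟨z, hz, hz1⟩ := exists_zmod_root_aux p m hm hdvd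
  have hp : 2 ≤ p := (Fact.out : p.Prime).two_le
  obtain ⟨a, ha⟩ : ∃ a : ℤ_[p], PadicInt.toZMod a = z := ⟨(z.val : ℤ_[p]), by simp⟩
  have hz0 : z ≠ 0 := by
    rintro rfl
    rw [zero_pow (by omega)] at hz
    exact zero_ne_one hz
  have hm0 : (m : ZMod p) ≠ 0 := by
    intro h
    rw [ZMod.natCast_eq_zero_iff] at h
    have := Nat.le_of_dvd (by omega) (h.trans hdvd)
    omega
  have h1 : ‖a ^ m - 1‖ < 1 := by
    rw [toZMod_norm_aux]; simp [ha, hz]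
  have h2 : ‖(m : ℤ_[p]) * a ^ (m - 1)‖ = 1 := by
    apply le_antisymm (PadicInt.norm_le_one _)
    by_contra h
    rw [not_le, toZMod_norm_aux] at h
    simp [ha, hz0, hm0] at h
  obtain ⟨x, hx, hxa, -⟩ := hensels_lemma (p := p) (R := ℤ_[p])
    (F := (Polynomial.X ^ m - 1 : Polynomial ℤ_[p])) (a := a) (by
      simp [Polynomial.derivative_X_pow] at h2 ⊢
      simpa [h2] using h1)
  refine ⟨x, ?_, ?_⟩
  · simpa [sub_eq_zero] using hx
  · have h3 : ‖x - a‖ < 1 := lt_of_lt_of_le hxa (PadicInt.norm_le_one _)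
    rw [toZMod_norm_aux, map_sub, sub_eq_zero, ha] at h3
    rwa [h3]

/-- Let `p` be a prime, `m ≥ 3` and `n ≥ 3` integers with `m` dividing
`p − 1`, and `r` a divisor of `m`.  Then the column space `F_p^n` is a simple module for the
mod `p` reduction of `G(m,r,n)`: the only subspaces of `F_p^n` invariant under the mod `p`
reductions of all matrices in `G(m,r,n)` are `0` and `F_p^n`. -/
theorem Gmrn_mod_p_reduction_irreducible
    (p m n r : ℕ) [Fact p.Prime] (hm : 3 ≤ m) (hn : 3 ≤ n)
    (hdvd : m ∣ p - 1) (hr : r ∣ m) :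
    ∀ V : Submodule (ZMod p) (Fin n → ZMod p),
      (∀ g : Matrix (Fin n) (Fin n) ℤ_[p], IsGmsnMatrix p m r n g →
        ∀ v ∈ V, (g.map (PadicInt.toZMod : ℤ_[p] → ZMod p)).mulVec v ∈ V) →
      V = ⊥ ∨ V = ⊤ := by
  intro V hV
  obtain ⟨x, hx, hx1⟩ := exists_padic_root_aux p m hm hdvd
  have key : ∀ (σ : Equiv.Perm (Fin n)) (d : Fin n → ℤ_[p]), (∀ j, d j ^ m = 1) →
      (∏ j, d j = 1) → ∀ v ∈ V,
      (fun i => PadicInt.toZMod (d (σ.symm i)) * v (σ.symm i)) ∈ V := by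
    intro σ d hd hp v hv
    have := hV (Matrix.of fun i j => if i = σ j then d j else 0)
      ⟨σ, d, hd, by rw [hp, one_pow], fun i j => rfl⟩ v hv
    convert this using 1
    funext i
    rw [Matrix.mulVec, dotProduct, Finset.sum_eq_single (σ.symm i)]
    · simp
    · intro b _ hb
      have : i ≠ σ b := by
        rintro rfl
        simp at hb
      simp [this]
    · simp
  set z : ZMod p := PadicInt.toZMod x with hzdef
  have diag : ∀ i j : Fin n, i ≠ j → ∀ v ∈ V,
      (Pi.single i ((z - 1) * v i) + Pi.single j ((z ^ (m - 1) - 1) * v j) :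
        Fin n → ZMod p) ∈ V := by
    intro i j hij v hv
    have h := key 1 (Pi.mulSingle i x * Pi.mulSingle j (x ^ (m - 1))) (by
      intro k
      have hxx : (x ^ (m - 1)) ^ m = 1 := by rw [← pow_mul, mul_comm, pow_mul, hx, one_pow]
      simp only [Pi.mul_apply, Pi.mulSingle_apply, mul_pow]
      split_ifs <;> simp [hx, hxx]) (by
      simp only [Pi.mul_apply, Finset.prod_mul_distrib, Finset.prod_pi_mulSingle']
      simp only [Finset.mem_univ, if_true]
      rw [mul_pow_sub_one (by omega), hx]) v hv
    convert V.sub_mem h hv using 1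
    funext k
    simp only [Pi.add_apply, Pi.single_apply, Pi.sub_apply, Pi.mul_apply, Pi.mulSingle_apply,
      Equiv.Perm.one_symm, Equiv.Perm.one_apply]
    by_cases h1 : k = i
    · subst h1
      simp [hij, ← hzdef]; ring
    · by_cases h2 : k = j
      · subst h2
        simp [h1, ← hzdef]; ring
      · simp [h1, h2]
  by_cases hbot : V = ⊥
  · exact Or.inl hbot
  right
  obtain ⟨v, hv, hv0⟩ := V.ne_bot_iff.1 hbot
  obtain ⟨i, hi⟩ := Function.ne_iff.1 hv0
  obtain ⟨j, hj⟩ : ∃ j, j ∉ ({i} : Finset (Fin n)) := by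
    by_contra! h
    have := Finset.card_le_card (fun a _ => h a : Finset.univ ⊆ ({i} : Finset (Fin n)))
    simp at this; omega
  obtain ⟨k, hk⟩ : ∃ k, k ∉ ({i, j} : Finset (Fin n)) := by
    by_contra! h
    have := Finset.card_le_card (fun a _ => h a : Finset.univ ⊆ ({i, j} : Finset (Fin n)))
    have h2 := Finset.card_le_two (a := i) (b := j)
    simp at this; omega
  simp only [Finset.mem_singleton, Finset.mem_insert, not_or] at hj hk
  have hw := diag i k (Ne.symm hk.1) _ (diag i j (Ne.symm hj) v hv)
  simp only [Pi.add_apply, Pi.single_apply, hk.1, hk.2, Ne.symm hj, if_true, if_false, add_zero,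
    mul_zero] at hw
  have hz1 : z - 1 ≠ 0 := sub_ne_zero.2 hx1
  have hi' : v i ≠ 0 := hi
  have hc : (z - 1) * ((z - 1) * v i) ≠ 0 := mul_ne_zero hz1 (mul_ne_zero hz1 hi')
  have hei : (Pi.single i 1 : Fin n → ZMod p) ∈ V := by
    have := V.smul_mem ((z - 1) * ((z - 1) * v i))⁻¹ hw
    rw [Pi.single_zero, add_zero, ← Pi.single_smul, smul_eq_mul, inv_mul_cancel₀ hc] at this
    exact this
  have he : ∀ l, (Pi.single l 1 : Fin n → ZMod p) ∈ V := by
    intro l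
    have := key (Equiv.swap i l) 1 (by simp) (by simp) _ hei
    convert this using 1
    funext t
    simp only [Pi.single_apply, Pi.one_apply, map_one, one_mul, Equiv.symm_swap]
    congr 1
    rw [Equiv.swap_apply_eq_iff, Equiv.swap_apply_left]
  rw [eq_top_iff]
  intro u _
  rw [pi_eq_sum_univ' u]
  exact V.sum_mem fun l _ => V.smul_mem _ (by convert he l using 1)
end
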